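/- arXiv:2211.13397 — 3 statements merged into one kernel-verified Lean document; each statement's English description precedes it below -/
import Mathlib

section
/- Let k be a positive integer. If G is a hyperbolic group that admits a finite inverse-closed generating set S such that Cay(G,S) is k-geodetic, then G is virtually free (has a free subgroup of finite index) and the centraliser in G of every element of infinite order is an infinite cyclic group. -/
/-- A connected simple graph is `k`-geodetic if between any pair of vertices there are
at most `k` geodesics (walks of minimal length between their endpoints). -/
def IsKGeodetic {V : Type*} (X : SimpleGraph V) (k : ℕ) : Prop :=
  X.Connected ∧ ∀ (u v : V) (s : Finset (X.Walk u v)),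
    (∀ p ∈ s, p.length = X.dist u v) → s.card ≤ k

/-- The (undirected) Cayley graph of a group `G` with respect to a subset `S`. -/
def cayleyGraph (G : Type*) [Group G] (S : Set G) : SimpleGraph G :=
  SimpleGraph.fromRel (fun g h => g⁻¹ * h ∈ S)

/-- A graph is (Gromov) hyperbolic if its path metric satisfies the four-point
condition for some `δ > 0`. -/
def IsHyperbolic {V : Type*} (X : SimpleGraph V) : Prop :=
  ∃ δ : ℝ, 0 < δ ∧ ∀ x y z w : V,
    (X.dist x y : ℝ) + (X.dist z w : ℝ) ≤
      max ((X.dist x z : ℝ) + (X.dist y w : ℝ)) ((X.dist x w : ℝ) + (X.dist y z : ℝ))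
        + 2 * δ

namespace KGeodetic

open SimpleGraph

section Geodesics

variable {V : Type*} {X : SimpleGraph V}

/-- The restriction of `p` to `[a, b]` is a geodesic of `X` parametrised by arc length. -/
def IsGeodesicOn (X : SimpleGraph V) (p : ℕ → V) (a b : ℕ) : Prop :=
  ∀ i j, a ≤ i → i ≤ j → j ≤ b → X.dist (p i) (p j) + i = j

theorem IsGeodesicOn.mono {p : ℕ → V} {a b a' b' : ℕ} (h : IsGeodesicOn X p a b)
    (ha : a ≤ a') (hb : b' ≤ b) : IsGeodesicOn X p a' b' :=
  fun i j hi hij hj => h i j (ha.trans hi) hij (hj.trans hb)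

theorem IsGeodesicOn.shift {p : ℕ → V} {a b r : ℕ} (h : IsGeodesicOn X p (a + r) (b + r)) :
    IsGeodesicOn X (fun i => p (i + r)) a b := by
  intro i j hi hij hj
  have := h (i + r) (j + r) (by omega) (by omega) (by omega)
  dsimp only
  omega

theorem isGeodesicOn_getVert (hX : X.Connected) {x y : V} (w : X.Walk x y)
    (hw : w.length = X.dist x y) : IsGeodesicOn X w.getVert 0 w.length := by
  have key : ∀ i j, i ≤ j → j ≤ w.length → X.dist (w.getVert i) (w.getVert j) + i ≤ j := by
    intro i j hij
    induction j, hij using Nat.le_induction with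
    | base => intro _; simp
    | succ j hij ih =>
      intro hj
      have h1 := ih (by omega)
      have h2 : X.dist (w.getVert j) (w.getVert (j + 1)) = 1 :=
        dist_eq_one_iff_adj.2 (w.adj_getVert_succ (by omega))
      have h3 := hX.dist_triangle (u := w.getVert i) (v := w.getVert j) (w := w.getVert (j + 1))
      omega
  intro i j _ hij hj
  have h1 := key i j hij hj
  have h2 := key 0 i (by omega) (by omega)
  have h3 := key j w.length hj le_rfl
  have h4 := hX.dist_triangle (u := w.getVert 0) (v := w.getVert i) (w := w.getVert w.length)
  have h5 := hX.dist_triangle (u := w.getVert i) (v := w.getVert j) (w := w.getVert w.length)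
  have h6 : X.dist (w.getVert 0) (w.getVert w.length) = w.length := by
    rw [Walk.getVert_zero, Walk.getVert_length, hw]
  omega

/-- A geodesic from `x` to `y` passing through a prescribed point `z` between them. -/
theorem exists_geodesic_through (hX : X.Connected) {x z y : V}
    (h : X.dist x z + X.dist z y = X.dist x y) :
    ∃ p : ℕ → V, p 0 = x ∧ p (X.dist x z) = z ∧ p (X.dist x y) = y ∧
      IsGeodesicOn X p 0 (X.dist x y) := by
  obtain ⟨w₁, h₁⟩ := hX.exists_walk_length_eq_dist x z
  obtain ⟨w₂, h₂⟩ := hX.exists_walk_length_eq_dist z y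
  have hl : (w₁.append w₂).length = X.dist x y := by rw [Walk.length_append]; omega
  refine ⟨(w₁.append w₂).getVert, by simp, ?_, ?_, ?_⟩
  · rw [← h₁, Walk.getVert_append]; simp
  · rw [← hl, Walk.getVert_length]
  · have := isGeodesicOn_getVert hX _ hl
    rwa [hl] at this

theorem exists_geodesic (hX : X.Connected) (x y : V) :
    ∃ p : ℕ → V, p 0 = x ∧ p (X.dist x y) = y ∧ IsGeodesicOn X p 0 (X.dist x y) := by
  obtain ⟨p, h0, -, h1, h2⟩ := exists_geodesic_through hX (x := x) (z := x) (y := y) (by simp)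
  exact ⟨p, h0, h1, h2⟩

theorem IsGeodesicOn.exists_walk {p : ℕ → V} {a b : ℕ} (h : IsGeodesicOn X p a b) (hab : a ≤ b) :
    ∃ w : X.Walk (p a) (p b), w.length + a = b ∧
      ∀ u ∈ w.support, ∃ m, a ≤ m ∧ m ≤ b ∧ u = p m := by
  induction b, hab using Nat.le_induction with
  | base => exact ⟨Walk.nil, by simp, by simpa using ⟨a, le_rfl, le_rfl, rfl⟩⟩
  | succ b hab ih =>
    obtain ⟨w, hw, hs⟩ := ih (h.mono le_rfl (by omega))
    have hadj : X.Adj (p b) (p (b + 1)) :=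
      dist_eq_one_iff_adj.1 (by have := h b (b + 1) hab (by omega) le_rfl; omega)
    refine ⟨w.concat hadj, by rw [Walk.length_concat]; omega, ?_⟩
    intro u hu
    rw [Walk.support_concat, List.mem_append, List.mem_singleton] at hu
    rcases hu with hu | rfl
    · obtain ⟨m, h1, h2, h3⟩ := hs u hu
      exact ⟨m, h1, by omega, h3⟩
    · exact ⟨b + 1, by omega, le_rfl, rfl⟩

theorem exists_walk_dist_le (hX : X.Connected) (x y : V) :
    ∃ w : X.Walk x y, w.length = X.dist x y ∧ ∀ u ∈ w.support, X.dist x u ≤ X.dist x y := by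
  classical
  obtain ⟨w, hw⟩ := hX.exists_walk_length_eq_dist x y
  exact ⟨w, hw, fun u hu => hw ▸ (dist_le (w.takeUntil u hu)).trans (w.length_takeUntil_le_length hu)⟩

end Geodesics

section Ladder

variable {V : Type*} {X : SimpleGraph V}

/-- In a `k`-geodetic graph, two disjoint geodesics cannot be joined by `k + 1` rungs, each of
which extends along both geodesics to a geodesic with the same endpoints. -/
theorem not_ladder {k : ℕ} (hX : IsKGeodetic X k) {p q : ℕ → V} {a b : ℕ}
    (hp : IsGeodesicOn X p a b) (hq : IsGeodesicOn X q a b)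
    (hpq : ∀ i j, a ≤ i → i ≤ b → a ≤ j → j ≤ b → p i ≠ q j)
    (u v : ℕ → ℕ) (hau : ∀ i, a ≤ u i) (huv : ∀ i ≤ k, u i ≤ v i) (hvb : ∀ i ≤ k, v i ≤ b)
    (g : ℤ) (hg : ∀ i ≤ k, (X.dist (p (u i)) (q (v i)) : ℤ) = v i - u i + g)
    (hgab : (X.dist (p a) (q b) : ℤ) = b - a + g)
    (hsep : ∀ i j, i < j → j ≤ k → (v i : ℤ) + g < u j ∧ u i < u j) : False := by
  classical
  have main : ∀ i : Fin (k + 1), ∃ w : X.Walk (p a) (q b), w.length = X.dist (p a) (q b) ∧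
      p (u i) ∈ w.support ∧ ∀ j : Fin (k + 1), i < j → p (u j) ∉ w.support := by
    intro i
    have hi : (i : ℕ) ≤ k := by omega
    have := hau i; have := huv i hi; have := hvb i hi
    obtain ⟨w₁, hw₁, hs₁⟩ := (hp.mono le_rfl (by omega : u i ≤ b)).exists_walk (hau i)
    obtain ⟨w₂, hw₂, hs₂⟩ := exists_walk_dist_le hX.1 (p (u i)) (q (v i))
    obtain ⟨w₃, hw₃, hs₃⟩ := (hq.mono (by omega : a ≤ v i) le_rfl).exists_walk (hvb i hi)
    have := hg i hi
    refine ⟨w₁.append (w₂.append w₃), ?_, ?_, ?_⟩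
    · simp only [Walk.length_append]; omega
    · rw [Walk.mem_support_append_iff]; exact Or.inl w₁.end_mem_support
    · intro j hij hmem
      have hj : (j : ℕ) ≤ k := by omega
      obtain ⟨hs1, hs2⟩ := hsep i j hij hj
      have := hau j; have := huv j hj; have := hvb j hj
      rw [Walk.mem_support_append_iff, Walk.mem_support_append_iff] at hmem
      rcases hmem with hm | hm | hm
      · obtain ⟨m, h1, h2, h3⟩ := hs₁ _ hm
        have e1 := hp m (u j) h1 (by omega) (by omega)
        rw [← h3] at e1
        simp at e1
        omega
      · have h1 := hs₂ _ hm
        have e1 := hp (u i) (u j) (by omega) (by omega) (by omega)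
        omega
      · obtain ⟨m, h1, h2, h3⟩ := hs₃ _ hm
        exact hpq _ _ (by omega) (by omega) (by omega) (by omega) h3
  choose w hw hmem hnot using main
  have hinj : Function.Injective w := by
    intro i j hij
    rcases lt_trichotomy i j with h | h | h
    · exact absurd (hij ▸ hmem j) (hnot i j h)
    · exact h
    · exact absurd (hij ▸ hmem i) (hnot j i h)
  have := hX.2 _ _ (Finset.univ.image w) (by simp [hw])
  rw [Finset.card_image_of_injective _ hinj] at this
  simp at this

/-- Two long geodesics of a `k`-geodetic graph that fellow travel at distance `D` must meet. -/
theorem exists_meet {k : ℕ} (hX : IsKGeodetic X k) (D : ℕ) :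
    ∃ L : ℕ, ∀ p q : ℕ → V, IsGeodesicOn X p 0 L → IsGeodesicOn X q 0 L →
      (∀ i ≤ L, X.dist (p i) (q i) ≤ D) → ∃ i j, i ≤ L ∧ j ≤ L ∧ p i = q j := by
  set N := 2 * (k + 1) with hN
  refine ⟨(D + 1) * N ^ (2 * D + 1), fun p q hp hq hD => ?_⟩
  set L := (D + 1) * N ^ (2 * D + 1) with hL
  by_contra! hne
  have upper : ∀ i j, i ≤ j → j ≤ L → (X.dist (p i) (q j) : ℤ) ≤ j - i + D := by
    intro i j hij hj
    have h1 := hp i j (by omega) hij hj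
    have h2 := hD j hj
    have h3 := hX.1.dist_triangle (u := p i) (v := p j) (w := q j)
    omega
  have lower : ∀ i j, i ≤ j → j ≤ L → (j : ℤ) - i - D ≤ X.dist (p i) (q j) := by
    intro i j hij hj
    have h1 := hp i j (by omega) hij hj
    have h2 := hD j hj
    have h3 := hX.1.dist_triangle (u := p i) (v := q j) (w := p j)
    rw [dist_comm (u := q j)] at h3
    omega
  have mono : ∀ i i' j' j, i ≤ i' → i' ≤ j' → j' ≤ j → j ≤ L →
      (X.dist (p i) (q j) : ℤ) - (j - i) ≤ X.dist (p i') (q j') - (j' - i') := by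
    intro i i' j' j h1 h2 h3 h4
    have e1 := hp i i' (by omega) h1 (by omega)
    have e2 := hq j' j (by omega) h3 (by omega)
    have e3 := hX.1.dist_triangle (u := p i) (v := p i') (w := q j)
    have e4 := hX.1.dist_triangle (u := p i') (v := q j') (w := q j)
    omega
  have claim : ∀ m a : ℕ, a + (D + 1) * N ^ m ≤ L →
      (X.dist (p a) (q (a + (D + 1) * N ^ m)) : ℤ) ≤ (D + 1) * N ^ m + D - m := by
    intro m
    induction m with
    | zero =>
      intro a ha
      have := upper a _ (by omega) ha
      push_cast at this ⊢
      linarith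
    | succ m ih =>
      intro a ha
      by_contra! hlt
      set s := (D + 1) * N ^ m with hs
      have hsN : (D + 1) * N ^ (m + 1) = s * N := by rw [hs]; ring
      have hsz : ((D : ℤ) + 1) * N ^ m = s := by rw [hs]; push_cast; ring
      have hsNz : ((D : ℤ) + 1) * N ^ (m + 1) = s * N := by rw [pow_succ, ← mul_assoc, hsz]
      have hDs : D + 1 ≤ s := Nat.le_mul_of_pos_right _ (by positivity)
      rw [hsN] at ha hlt
      rw [hsNz] at hlt
      rw [hsz] at ih
      have hle : ∀ i, i < N → i * s + s ≤ s * N := by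
        intro i hi
        calc i * s + s = s * (i + 1) := by ring
          _ ≤ s * N := Nat.mul_le_mul_left _ hi
      have hrung : ∀ i, i < N →
          (X.dist (p (a + i * s)) (q (a + i * s + s)) : ℤ) = s + D - m := by
        intro i hi
        have h1 := hle i hi
        have h2 := ih (a + i * s) (by omega)
        have h3 := mono a (a + i * s) (a + i * s + s) (a + s * N) (by omega) (by omega) (by omega) ha
        push_cast at h3 hlt ⊢
        linarith
      have htot : (X.dist (p a) (q (a + s * N)) : ℤ) = s * N + D - m := by
        have h3 := mono a (a + 0 * s) (a + 0 * s + s) (a + s * N) (by omega) (by omega)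
          (by have := hle 0 (by omega); omega) ha
        have h4 := hrung 0 (by omega)
        push_cast at h3 h4 hlt ⊢
        linarith
      have hm : (m : ℤ) ≤ m := le_rfl
      refine not_ladder hX (a := a) (b := a + s * N) (hp.mono (by omega) ha)
        (hq.mono (by omega) ha) (fun i j _ hi _ hj => hne i j (by omega) (by omega))
        (fun i => a + (2 * i) * s) (fun i => a + (2 * i) * s + s) (by intro i; omega)
        (by intro i _; omega) ?_ (D - m) ?_ ?_ ?_
      · intro i hi
        have := hle (2 * i) (by omega)
        omega
      · intro i hi
        have := hrung (2 * i) (by omega)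
        push_cast at this ⊢
        linarith
      · rw [htot]; push_cast; ring
      · intro i j hij hj
        have h1 : (2 * i + 2) * s ≤ 2 * j * s := Nat.mul_le_mul_right _ (by omega)
        have h2 : (2 * i + 2) * s = 2 * i * s + s + s := by ring
        constructor
        · push_cast
          have : ((2 * i + 2) * s : ℤ) ≤ 2 * j * s := by exact_mod_cast h1
          have h3 : (D : ℤ) + 1 ≤ s := by exact_mod_cast hDs
          nlinarith
        · omega
  have h1 := claim (2 * D + 1) 0 (by omega)
  have h2 := lower 0 (0 + (D + 1) * N ^ (2 * D + 1)) (by omega) (by omega)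
  push_cast at h1 h2
  linarith

end Ladder

end KGeodetic

namespace KGeodetic

open SimpleGraph

section Slices

variable {V : Type*} {X : SimpleGraph V}

/-- The points at distance `r` from `o` that lie on a geodesic from `o` to `x`. -/
def geodesicSlice (X : SimpleGraph V) (o : V) (r : ℕ) (x : V) : Set V :=
  {z | X.dist o z = r ∧ X.dist o z + X.dist z x = X.dist o x}

/-- The four-point condition with an integral constant. -/
def FourPoint (X : SimpleGraph V) (E : ℕ) : Prop :=
  ∀ x y z w, X.dist x y + X.dist z w ≤
    max (X.dist x z + X.dist y w) (X.dist x w + X.dist y z) + E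

theorem _root_.IsHyperbolic.exists_fourPoint (h : IsHyperbolic X) : ∃ E, FourPoint X E := by
  obtain ⟨δ, -, h⟩ := h
  refine ⟨⌈2 * δ⌉₊, fun x y z w => ?_⟩
  have h1 := h x y z w
  have h2 := Nat.le_ceil (2 * δ)
  have h3 : ((X.dist x y + X.dist z w : ℕ) : ℝ) ≤
      ((max (X.dist x z + X.dist y w) (X.dist x w + X.dist y z) + ⌈2 * δ⌉₊ : ℕ) : ℝ) := by
    push_cast
    linarith
  exact_mod_cast h3

theorem FourPoint.dist_le_of_mem_geodesicSlice {E : ℕ} (hE : FourPoint X E) (hX : X.Connected)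
    {o o' x y z z' : V} {r : ℕ} (hz : z ∈ geodesicSlice X o r x)
    (hz' : z' ∈ geodesicSlice X o' r y) :
    X.dist z z' ≤ X.dist o o' + 2 * X.dist x y + E := by
  obtain ⟨h1, h2⟩ := hz
  obtain ⟨h3, h4⟩ := hz'
  have h5 := hE z z' o x
  have h6 := hX.dist_triangle (u := z') (v := y) (w := x)
  have h7 := hX.dist_triangle (u := z') (v := o') (w := o)
  have h8 := hX.dist_triangle (u := o') (v := o) (w := y)
  have h9 := hX.dist_triangle (u := o) (v := x) (w := y)
  rw [dist_comm (u := z') (v := o'), dist_comm (u := o') (v := o)] at h7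
  rw [dist_comm (u := o') (v := o)] at h8
  rw [dist_comm (u := y) (v := x)] at h6
  rw [dist_comm (u := z) (v := o)] at h5
  omega

theorem IsGeodesicOn.mem_geodesicSlice {p : ℕ → V} {n i : ℕ} (hp : IsGeodesicOn X p 0 n)
    (hi : i ≤ n) : p i ∈ geodesicSlice X (p 0) i (p n) := by
  have h1 := hp 0 i le_rfl (by omega) hi
  have h2 := hp i n (by omega) hi le_rfl
  have h3 := hp 0 n le_rfl (by omega) le_rfl
  exact ⟨by omega, by omega⟩

/-- Far from its end, a geodesic slice does not change when the endpoint moves to a neighbour. -/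
theorem exists_geodesicSlice_subset {k E : ℕ} (hX : IsKGeodetic X k) (hE : FourPoint X E) :
    ∃ L : ℕ, ∀ o x y r, X.Adj x y → r + L ≤ X.dist o x → r + L ≤ X.dist o y →
      geodesicSlice X o r x ⊆ geodesicSlice X o r y := by
  obtain ⟨L, hL⟩ := exists_meet hX (2 + E)
  refine ⟨L, fun o x y r hxy hx hy z hz => ?_⟩
  obtain ⟨p, hp0, hpz, hpx, hp⟩ := exists_geodesic_through hX.1 hz.2
  obtain ⟨q, hq0, hqy, hq⟩ := exists_geodesic hX.1 o y
  have hxy1 := dist_eq_one_iff_adj.2 hxy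
  obtain ⟨i, j, hi, hj, hij⟩ := hL (fun i => p (i + r)) (fun i => q (i + r))
    (IsGeodesicOn.shift (hp.mono (by omega) (by omega)))
    (IsGeodesicOn.shift (hq.mono (by omega) (by omega))) (by
      intro i hi
      have h1 := hp.mem_geodesicSlice (i := i + r) (by omega)
      have h2 := hq.mem_geodesicSlice (i := i + r) (by omega)
      rw [hp0, hpx] at h1
      rw [hq0, hqy] at h2
      have := hE.dist_le_of_mem_geodesicSlice hX.1 h1 h2
      rw [dist_self, hxy1] at this
      omega)
  have h1 := hp 0 (i + r) le_rfl (by omega) (by omega)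
  have h2 := hq 0 (j + r) le_rfl (by omega) (by omega)
  rw [hp0, hij] at h1
  rw [hq0] at h2
  have h3 := hp r (i + r) (by omega) (by omega) (by omega)
  have h4 := hq (j + r) (X.dist o y) (by omega) (by omega) le_rfl
  have h5 : X.dist o z = r := hz.1
  rw [h5] at hpz
  rw [hpz, hij] at h3
  rw [hqy] at h4
  have h6 := hX.1.dist_triangle (u := z) (v := q (j + r)) (w := y)
  have h7 := hX.1.dist_triangle (u := o) (v := z) (w := y)
  exact ⟨h5, by omega⟩

/-- The vertices that can be reached from `x` without entering the open ball of radius `n`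
around `o`. -/
def outerComponent (X : SimpleGraph V) (o : V) (n : ℕ) (x : V) : Set V :=
  {y | Relation.ReflTransGen (fun a b => X.Adj a b ∧ n ≤ X.dist o b) x y}

theorem le_dist_of_mem_outerComponent {o x y : V} {n : ℕ} (hx : n ≤ X.dist o x)
    (hy : y ∈ outerComponent X o n x) : n ≤ X.dist o y := by
  induction hy with
  | refl => exact hx
  | tail _ h _ => exact h.2

theorem exists_mem_outerComponent (hX : X.Connected) {o x : V} {n : ℕ} (hx : n ≤ X.dist o x) :
    ∃ s, X.dist o s = n ∧ x ∈ outerComponent X o n s := by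
  obtain ⟨p, hp0, hpx, hp⟩ := exists_geodesic hX o x
  refine ⟨p n, ?_, ?_⟩
  · have := hp 0 n le_rfl (by omega) hx
    rw [hp0] at this
    omega
  · have : ∀ m, n ≤ m → m ≤ X.dist o x → p m ∈ outerComponent X o n (p n) := by
      intro m hm
      induction m, hm using Nat.le_induction with
      | base => intro _; exact Relation.ReflTransGen.refl
      | succ m hm ih =>
        intro hmx
        have h1 := hp m (m + 1) (by omega) (by omega) hmx
        have h2 := hp 0 (m + 1) (by omega) (by omega) hmx
        rw [hp0] at h2
        exact (ih (by omega)).tail ⟨dist_eq_one_iff_adj.1 (by omega), by omega⟩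
    have h := this _ hx le_rfl
    rwa [hpx] at h

/-- The edges leaving `C`, oriented outwards. -/
def edgeBoundary (X : SimpleGraph V) (C : Set V) : Set (V × V) :=
  {e | X.Adj e.1 e.2 ∧ e.1 ∈ C ∧ e.2 ∉ C}

theorem outerComponent_subset_of_edgeBoundary {o x : V} {n : ℕ} {D : Set V}
    (hD : ∀ e ∈ edgeBoundary X D, X.dist o e.2 < n) (hx : x ∈ D) :
    outerComponent X o n x ⊆ D := by
  intro y hy
  induction hy with
  | refl => exact hx
  | @tail a b _ h ih =>
    by_contra hb
    have := hD (a, b) ⟨h.1, ih, hb⟩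
    dsimp only at this
    omega

end Slices

/-- The properties shared by all locally finite connected Cayley graphs. -/
structure IsLeftInvariant {G : Type*} [Group G] (X : SimpleGraph G) : Prop where
  connected : X.Connected
  adj_mul : ∀ c x y, X.Adj (c * x) (c * y) ↔ X.Adj x y
  finite_adj : ∀ x, {y | X.Adj x y}.Finite

section Group

variable {G : Type*} [Group G] {X : SimpleGraph G}

theorem IsLeftInvariant.dist_mul (h : IsLeftInvariant X) (c x y : G) :
    X.dist (c * x) (c * y) = X.dist x y := by
  have key : ∀ c x y, X.dist (c * x) (c * y) ≤ X.dist x y := by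
    intro c x y
    obtain ⟨w, hw⟩ := h.connected.exists_walk_length_eq_dist x y
    let f : X →g X := ⟨fun g => c * g, fun {a b} hab => (h.adj_mul c a b).2 hab⟩
    rw [← hw, ← Walk.length_map f w]
    exact dist_le _
  refine le_antisymm (key c x y) ?_
  simpa using key c⁻¹ (c * x) (c * y)

theorem IsLeftInvariant.finite_ball (h : IsLeftInvariant X) (x : G) (r : ℕ) :
    {y | X.dist x y ≤ r}.Finite := by
  induction r with
  | zero =>
    refine (Set.finite_singleton x).subset fun y hy => ?_
    have : X.dist x y = 0 := by simpa using hy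
    exact ((h.connected.dist_eq_zero_iff).1 this).symm
  | succ r ih =>
    refine (ih.union (ih.biUnion fun y _ => h.finite_adj y)).subset fun y hy => ?_
    by_cases hyr : X.dist x y ≤ r
    · exact Or.inl hyr
    · right
      have hy' : X.dist x y = r + 1 := le_antisymm hy (by omega)
      obtain ⟨p, hp0, hpx, hp⟩ := exists_geodesic h.connected x y
      have h1 := hp 0 r le_rfl (by omega) (by omega)
      have h2 := hp r (r + 1) (by omega) (by omega) (by omega)
      rw [hy'] at hpx
      rw [hpx] at h2
      rw [hp0] at h1
      simp only [Set.mem_iUnion]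
      exact ⟨p r, show X.dist x (p r) ≤ r by omega, dist_eq_one_iff_adj.1 (by omega)⟩

theorem IsLeftInvariant.mem_geodesicSlice_mul (h : IsLeftInvariant X) {o x z : G} {r : ℕ}
    (hz : z ∈ geodesicSlice X o r x) (c : G) :
    c * z ∈ geodesicSlice X (c * o) r (c * x) := by
  obtain ⟨h1, h2⟩ := hz
  refine ⟨?_, ?_⟩ <;> simp only [h.dist_mul] <;> assumption

/-- A geodesic ray. -/
def IsGeodesicRay (X : SimpleGraph G) (p : ℕ → G) : Prop :=
  ∀ i j, i ≤ j → X.dist (p i) (p j) + i = j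

theorem IsLeftInvariant.exists_ray (h : IsLeftInvariant X) {ι : Type*} (U : Ultrafilter ι)
    (f : ι → G) (hf : ∀ r, ∀ᶠ i in U, r ≤ X.dist 1 (f i)) :
    ∃ p : ℕ → G, IsGeodesicRay X p ∧ ∀ j, ∀ᶠ i in U, p j ∈ geodesicSlice X 1 j (f i) := by
  choose γ hγ0 hγ1 hγ using fun i => exists_geodesic h.connected 1 (f i)
  have hlim : ∀ j, ∃ a, ∀ᶠ i in U, γ i j = a := by
    intro j
    have h1 : ∀ᶠ i in U, ∃ a ∈ {y | X.dist 1 y ≤ j}, γ i j = a := by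
      filter_upwards [hf j] with i hi
      have := hγ i 0 j le_rfl (by omega) hi
      rw [hγ0] at this
      exact ⟨γ i j, show X.dist 1 (γ i j) ≤ j by omega, rfl⟩
    obtain ⟨a, -, ha⟩ := (Ultrafilter.eventually_exists_mem_iff (h.finite_ball 1 j)).1 h1
    exact ⟨a, ha⟩
  choose p hp using hlim
  refine ⟨p, fun a b hab => ?_, fun j => ?_⟩
  · obtain ⟨i, h1, h2, h3⟩ := ((hf b).and ((hp a).and (hp b))).exists
    rw [← h2, ← h3]
    exact hγ i a b (by omega) hab h1
  · filter_upwards [hf j, hp j] with i h1 h2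
    have := (hγ i).mem_geodesicSlice h1
    rwa [hγ0, hγ1, h2] at this

/-- A group that moves a geodesic ray of a `k`-geodetic Cayley graph only by bounded amounts
acts on its Busemann function by integer translations, and faithfully so. -/
theorem IsLeftInvariant.exists_busemann (h : IsLeftInvariant X) {k : ℕ} (hk : IsKGeodetic X k)
    {p : ℕ → G} (hp : IsGeodesicRay X p) (H : Subgroup G)
    (hH : ∀ c ∈ H, ∃ D, ∀ j, X.dist (p j) (c * p j) ≤ D) :
    ∃ (b : G → ℤ) (f : H →* Multiplicative ℤ), Function.Injective f ∧
      (∀ x, ∀ᶠ n : ℕ in Filter.atTop, (X.dist x (p n) : ℤ) - n = b x) ∧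
      ∀ (c : H) x, b (c * x) = b x + Multiplicative.toAdd (f c) := by
  have hb : ∀ x, ∃ B : ℤ, ∀ᶠ n : ℕ in Filter.atTop, (X.dist x (p n) : ℤ) - n = B := by
    intro x
    have h0 : ∀ n, n ≤ X.dist x (p n) + X.dist x (p 0) := by
      intro n
      have h1 := hp 0 n (by omega)
      have h2 := h.connected.dist_triangle (u := p 0) (v := x) (w := p n)
      rw [dist_comm (u := p 0) (v := x)] at h2
      omega
    let a : ℕ → ℕ := fun n => X.dist x (p n) + X.dist x (p 0) - n
    refine ⟨X.dist x (p (Function.argmin a)) - (Function.argmin a : ℕ), ?_⟩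
    filter_upwards [Filter.eventually_ge_atTop (Function.argmin a)] with n hn
    have h1 : a (Function.argmin a) ≤ a n := Function.argmin_le a n
    have h2 := h.connected.dist_triangle (u := x) (v := p (Function.argmin a)) (w := p n)
    have h3 := hp _ n hn
    have h4 := h0 n
    have h5 := h0 (Function.argmin a)
    simp only [a] at h1 h2 h3 h5 hn ⊢
    omega
  choose b hb using hb
  have meet : ∀ c ∈ H, ∀ M, ∃ i j, M ≤ i ∧ M ≤ j ∧ p i = c * p j := by
    intro c hc M
    obtain ⟨D, hD⟩ := hH c hc
    obtain ⟨L, hL⟩ := exists_meet hk D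
    obtain ⟨i, j, -, -, hij⟩ := hL (fun i => p (i + M)) (fun i => c * p (i + M))
      (fun i j _ hij _ => by have := hp (i + M) (j + M) (by omega); dsimp only; omega)
      (fun i j _ hij _ => by
        have := hp (i + M) (j + M) (by omega); simp only [h.dist_mul]; omega)
      (fun i _ => hD _)
    exact ⟨i + M, j + M, by omega, by omega, hij⟩
  have shift : ∀ c ∈ H, ∀ x y, ∃ i j : ℕ, p i = c * p j ∧ b (c * x) = b x + (j - i) ∧
      b (c * y) = b y + (j - i) := by
    intro c hc x y
    obtain ⟨M, hM⟩ := Filter.eventually_atTop.1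
      ((hb x).and ((hb y).and ((hb (c * x)).and (hb (c * y)))))
    obtain ⟨i, j, hi, hj, hij⟩ := meet c hc M
    obtain ⟨h1, h2, -, -⟩ := hM j hj
    obtain ⟨-, -, h3, h4⟩ := hM i hi
    rw [hij, h.dist_mul] at h3 h4
    exact ⟨i, j, hij, by omega, by omega⟩
  have hadd : ∀ c ∈ H, ∀ x, b (c * x) = b x + (b c - b 1) := by
    intro c hc x
    obtain ⟨i, j, -, h1, h2⟩ := shift c hc x 1
    rw [mul_one] at h2
    omega
  let f : H →* Multiplicative ℤ :=
    { toFun := fun c => Multiplicative.ofAdd (b c - b 1)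
      map_one' := by simp
      map_mul' := by
        intro c d
        rw [← ofAdd_add]
        congr 1
        have := hadd c c.2 d
        push_cast
        omega }
  refine ⟨b, f, ?_, hb, fun c x => hadd c c.2 x⟩
  rw [injective_iff_map_eq_one]
  intro c hc
  have h0 : b c - b 1 = 0 := Multiplicative.ofAdd.injective hc
  obtain ⟨i, j, hij, h1, -⟩ := shift c c.2 1 1
  rw [mul_one] at h1
  have : i = j := by omega
  subst this
  exact Subtype.ext (by simpa using hij)

end Group

end KGeodetic

namespace KGeodetic

open SimpleGraph Filter

section Centralizer

variable {G : Type*} [Group G] {X : SimpleGraph G}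

/-- A nontrivial group that embeds into the integers is infinite cyclic. -/
theorem nonempty_mulEquiv_int_of_injective {H : Type*} [Group H] (f : H →* Multiplicative ℤ)
    (hf : Function.Injective f) {x : H} (hx : x ≠ 1) : Nonempty (H ≃* Multiplicative ℤ) := by
  have := isCyclic_of_injective f hf
  have : Infinite H := by
    refine Infinite.of_injective (fun n : ℤ => x ^ n) ?_
    rw [injective_zpow_iff_not_isOfFinOrder]
    intro h
    obtain ⟨n, hn, hxn⟩ := isOfFinOrder_iff_pow_eq_one.1 h
    apply hx
    apply hf
    have h1 : (n : ℤ) * Multiplicative.toAdd (f x) = 0 := by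
      have := congrArg (fun y => Multiplicative.toAdd (f y)) hxn
      simpa using this
    rw [map_one]
    apply Multiplicative.toAdd.injective
    rw [toAdd_one]
    rcases mul_eq_zero.1 h1 with h | h
    · omega
    · exact h
  obtain ⟨g, hg⟩ := IsCyclic.exists_generator (α := H)
  exact ⟨(intEquivOfZPowersEqTop g ((Subgroup.eq_top_iff' _).2 hg)).symm⟩

theorem IsLeftInvariant.eventually_le_dist (h : IsLeftInvariant X) (r : ℕ) :
    ∀ᶠ x in cofinite, r ≤ X.dist 1 x := by
  refine (h.finite_ball 1 r).subset fun x hx => ?_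
  have : ¬ r ≤ X.dist 1 x := hx
  show X.dist 1 x ≤ r
  omega

theorem IsLeftInvariant.nonempty_centralizer_mulEquiv (h : IsLeftInvariant X) {k : ℕ}
    (hk : IsKGeodetic X k) (hX : IsHyperbolic X) {g : G} (hg : ¬ IsOfFinOrder g) :
    Nonempty (Subgroup.centralizer {g} ≃* Multiplicative ℤ) := by
  obtain ⟨E, hE⟩ := hX.exists_fourPoint
  have hinj := injective_pow_iff_not_isOfFinOrder.2 hg
  obtain ⟨p, hp, hslice⟩ := h.exists_ray (hyperfilter ℕ) (fun n => g ^ n) fun r =>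
    hyperfilter_le_cofinite ((hinj.tendsto_cofinite).eventually (h.eventually_le_dist r))
  obtain ⟨-, f, hf, -, -⟩ := h.exists_busemann hk hp (Subgroup.centralizer {g}) fun c hc => by
    refine ⟨X.dist 1 c + 2 * X.dist 1 c + E, fun j => ?_⟩
    obtain ⟨n, hn⟩ := (hslice j).exists
    have h1 := hE.dist_le_of_mem_geodesicSlice h.connected hn (h.mem_geodesicSlice_mul hn c)
    have h2 : c * g ^ n = g ^ n * c :=
      (Commute.pow_right (Subgroup.mem_centralizer_singleton_iff.1 hc : Commute _ _) n).eq
    have h3 := h.dist_mul (g ^ n) 1 c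
    rw [mul_one] at h3
    rwa [h2, h3, mul_one] at h1
  refine nonempty_mulEquiv_int_of_injective f hf
    (x := ⟨g, Subgroup.mem_centralizer_singleton_iff.2 rfl⟩) fun h1 => hg ?_
  rw [show g = 1 from congrArg Subtype.val h1]
  exact IsOfFinOrder.one

end Centralizer

section Ends

variable {V : Type*} {X : SimpleGraph V}

theorem geodesicSlice_eq_of_mem_outerComponent {L : ℕ}
    (hL : ∀ o x y r, X.Adj x y → r + L ≤ X.dist o x → r + L ≤ X.dist o y →
      geodesicSlice X o r x ⊆ geodesicSlice X o r y) {o x y : V} {r : ℕ}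
    (hx : r + L ≤ X.dist o x) (hy : y ∈ outerComponent X o (r + L) x) :
    geodesicSlice X o r y = geodesicSlice X o r x := by
  induction hy with
  | refl => rfl
  | tail ha hb ih =>
    rw [← ih]
    have := le_dist_of_mem_outerComponent hx ha
    exact (hL _ _ _ _ hb.1.symm hb.2 this).antisymm (hL _ _ _ _ hb.1 this hb.2)

theorem mem_outerComponent_symm {o x y : V} {n : ℕ} (hx : n ≤ X.dist o x)
    (hy : y ∈ outerComponent X o n x) : x ∈ outerComponent X o n y := by
  induction hy with
  | refl => exact Relation.ReflTransGen.refl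
  | tail ha hb ih =>
    exact Relation.ReflTransGen.head ⟨hb.1.symm, le_dist_of_mem_outerComponent hx ha⟩ ih

variable {G : Type*} [Group G] {X : SimpleGraph G}

theorem IsLeftInvariant.exists_ncard_edgeBoundary_le (h : IsLeftInvariant X) {k : ℕ}
    (hk : IsKGeodetic X k) (hX : IsHyperbolic X) :
    ∃ K L, ∀ n, L ≤ n → ∀ x, n ≤ X.dist 1 x → (edgeBoundary X (outerComponent X 1 n x)).Finite ∧
      (edgeBoundary X (outerComponent X 1 n x)).ncard ≤ K := by
  obtain ⟨E, hE⟩ := hX.exists_fourPoint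
  obtain ⟨L, hL⟩ := exists_geodesicSlice_subset hk hE
  have hB := h.finite_ball 1 (L + 1)
  set B := {y | X.dist 1 y ≤ L + 1} with hBdef
  refine ⟨(B ×ˢ B).ncard, L, fun n hn x hx => ?_⟩
  obtain ⟨r, rfl⟩ := Nat.exists_eq_add_of_le' hn
  obtain ⟨p, hp0, hpx, hp⟩ := exists_geodesic h.connected 1 x
  have hz := hp.mem_geodesicSlice (i := r) (by omega)
  rw [hp0, hpx] at hz
  set z := p r
  have hsub : edgeBoundary X (outerComponent X 1 (r + L) x) ⊆
      (fun e => (z * e.1, z * e.2)) '' (B ×ˢ B) := by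
    rintro ⟨u, v⟩ ⟨huv, hu, hv⟩
    dsimp only at huv hu hv
    have h1 := le_dist_of_mem_outerComponent hx hu
    have h2 : ¬ r + L ≤ X.dist 1 v := fun hc => hv (hu.tail ⟨huv, hc⟩)
    have h3 : X.dist v u = 1 := dist_eq_one_iff_adj.2 huv.symm
    have h3' : X.dist u v = 1 := dist_eq_one_iff_adj.2 huv
    have h4 := h.connected.dist_triangle (u := 1) (v := v) (w := u)
    rw [← geodesicSlice_eq_of_mem_outerComponent hL hx hu] at hz
    obtain ⟨h5, h6⟩ := hz
    have h7 := h.connected.dist_triangle (u := z) (v := u) (w := v)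
    have h8 := h.dist_mul z 1 (z⁻¹ * u)
    have h9 := h.dist_mul z 1 (z⁻¹ * v)
    rw [mul_one, mul_inv_cancel_left] at h8 h9
    refine ⟨(z⁻¹ * u, z⁻¹ * v), ⟨?_, ?_⟩, by simp⟩
    · show X.dist 1 (z⁻¹ * u) ≤ L + 1
      omega
    · show X.dist 1 (z⁻¹ * v) ≤ L + 1
      omega
  have hfin := (hB.prod hB)
  exact ⟨(hfin.image _).subset hsub, (Set.ncard_le_ncard hsub (hfin.image _)).trans
    (Set.ncard_image_le hfin)⟩

theorem IsLeftInvariant.exists_subset_ncard_edgeBoundary_le (h : IsLeftInvariant X) {k : ℕ}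
    (hk : IsKGeodetic X k) (hX : IsHyperbolic X) :
    ∃ K, ∀ (ω : Ultrafilter G), (ω : Filter G) ≤ cofinite → ∀ D ∈ ω, (edgeBoundary X D).Finite →
      ∃ C ⊆ D, C ∈ ω ∧ (edgeBoundary X C).Finite ∧ (edgeBoundary X C).ncard ≤ K := by
  obtain ⟨K, L, hKL⟩ := h.exists_ncard_edgeBoundary_le hk hX
  refine ⟨K, fun ω hω D hD hfin => ?_⟩
  obtain ⟨M, hM⟩ := (hfin.image fun e => X.dist 1 e.2).bddAbove
  set n := max L (M + 1)
  have h1 : ∀ᶠ x in ω, ∃ s ∈ {s | X.dist 1 s ≤ n},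
      X.dist 1 s = n ∧ x ∈ outerComponent X 1 n s ∧ x ∈ D := by
    filter_upwards [hω (h.eventually_le_dist n), hD] with x hx hxD
    obtain ⟨s, hs, hxs⟩ := exists_mem_outerComponent h.connected hx
    exact ⟨s, hs.le, hs, hxs, hxD⟩
  obtain ⟨s, -, hs⟩ := (Ultrafilter.eventually_exists_mem_iff (h.finite_ball 1 n)).1 h1
  obtain ⟨x, hsn, hxs, hxD⟩ := hs.exists
  have hDn : ∀ e ∈ edgeBoundary X D, X.dist 1 e.2 < n := fun e he =>
    lt_of_lt_of_le (Nat.lt_succ_of_le (hM ⟨e, he, rfl⟩)) (le_max_right _ _)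
  have hsD : s ∈ D := outerComponent_subset_of_edgeBoundary hDn hxD
    (mem_outerComponent_symm hsn.ge hxs)
  exact ⟨_, outerComponent_subset_of_edgeBoundary hDn hsD, hs.mono fun x hx => hx.2.1,
    hKL n (le_max_left _ _) s hsn.ge⟩

theorem IsLeftInvariant.exists_finite_edgeBoundary_slice (h : IsLeftInvariant X) {k : ℕ}
    (hk : IsKGeodetic X k) (hX : IsHyperbolic X) (j : ℕ) (z : G) :
    (edgeBoundary X {x | z ∈ geodesicSlice X 1 j x}).Finite := by
  obtain ⟨E, hE⟩ := hX.exists_fourPoint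
  obtain ⟨L, hL⟩ := exists_geodesicSlice_subset hk hE
  have hB := h.finite_ball 1 (j + L + 1)
  refine (hB.prod hB).subset ?_
  rintro ⟨u, v⟩ ⟨huv, hu, hv⟩
  dsimp only at huv hu hv
  have h1 : ¬ (j + L ≤ X.dist 1 u ∧ j + L ≤ X.dist 1 v) := fun hc =>
    hv (hL _ _ _ _ huv hc.1 hc.2 hu)
  have h2 : X.dist v u = 1 := dist_eq_one_iff_adj.2 huv.symm
  have h3 : X.dist u v = 1 := dist_eq_one_iff_adj.2 huv
  have h4 := h.connected.dist_triangle (u := 1) (v := v) (w := u)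
  have h5 := h.connected.dist_triangle (u := 1) (v := u) (w := v)
  refine ⟨?_, ?_⟩
  · show X.dist 1 u ≤ j + L + 1
    omega
  · show X.dist 1 v ≤ j + L + 1
    omega

theorem exists_le_succ_of_nat (ℓ : ℕ → ℕ) : ∃ᶠ n in atTop, ℓ n ≤ ℓ (n + 1) := by
  rw [Filter.frequently_atTop]
  intro N
  by_contra! hc
  have : ∀ i, ℓ (N + i) + i ≤ ℓ N := by
    intro i
    induction i with
    | zero => simp
    | succ i ih =>
      have := hc (N + i) (by omega)
      rw [add_assoc] at this
      omega
  have := this (ℓ N + 1)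
  omega

/-- Every infinite subgroup is split by a cut into two infinite parts. -/
theorem IsLeftInvariant.exists_splitting (h : IsLeftInvariant X) {k : ℕ}
    (hk : IsKGeodetic X k) (hX : IsHyperbolic X) (H : Subgroup G) (hH : (H : Set G).Infinite) :
    ∃ D, (edgeBoundary X D).Finite ∧ ((H : Set G) ∩ D).Infinite ∧ ((H : Set G) ∩ Dᶜ).Infinite := by
  by_contra! hD
  have : Infinite H := hH.to_subtype
  obtain ⟨E, hE⟩ := hX.exists_fourPoint
  obtain ⟨p, hp, hslice⟩ := h.exists_ray (hyperfilter H) Subtype.val fun r =>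
    hyperfilter_le_cofinite ((Subtype.val_injective.tendsto_cofinite).eventually
      (h.eventually_le_dist r))
  have hcof : ∀ j, ∀ᶠ x : H in cofinite, p j ∈ geodesicSlice X 1 j x := by
    intro j
    have h1 : ((H : Set G) ∩ {x | p j ∈ geodesicSlice X 1 j x}).Infinite := by
      intro hfin
      refine notMem_hyperfilter_of_finite (α := H) (hfin.preimage Subtype.val_injective.injOn) ?_
      filter_upwards [hslice j] with x hx
      exact ⟨x.2, hx⟩
    have h2 := hD _ (h.exists_finite_edgeBoundary_slice hk hX j (p j)) h1
    refine (h2.preimage (f := Subtype.val) Subtype.val_injective.injOn).subset fun x hx => ?_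
    exact ⟨x.2, hx⟩
  obtain ⟨b, f, hf, hb, hbf⟩ := h.exists_busemann hk hp H fun c hc => by
    refine ⟨X.dist 1 c + E, fun j => ?_⟩
    have h1 : Tendsto (fun x : H => (⟨c, hc⟩⁻¹ : H) * x) cofinite cofinite :=
      (mul_right_injective _).tendsto_cofinite
    obtain ⟨x, hx, hx'⟩ := ((hcof j).and (h1.eventually (hcof j))).exists
    have h2 := h.mem_geodesicSlice_mul hx' c
    simp only [Subgroup.coe_mul, Subgroup.coe_inv, mul_inv_cancel_left, mul_one] at h2
    have h3 := hE.dist_le_of_mem_geodesicSlice h.connected hx h2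
    rw [SimpleGraph.dist_self] at h3
    omega
  obtain ⟨g, hg⟩ := exists_ne (1 : H)
  have hord : ¬ IsOfFinOrder (f g) := by
    intro hfo
    obtain ⟨n, hn, hxn⟩ := isOfFinOrder_iff_pow_eq_one.1 hfo
    have h1 : (n : ℤ) * Multiplicative.toAdd (f g) = 0 := by
      have := congrArg Multiplicative.toAdd hxn
      simpa using this
    apply hg
    apply hf
    rw [map_one]
    apply Multiplicative.toAdd.injective
    rw [toAdd_one]
    rcases mul_eq_zero.1 h1 with h | h
    · omega
    · exact h
  have hinj : Function.Injective fun n : ℕ => g ^ n :=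
    injective_pow_iff_not_isOfFinOrder.2 fun hfo => hord (f.isOfFinOrder hfo)
  have hinj' : Function.Injective fun n : ℕ => (g ^ n)⁻¹ := fun a b hab => hinj (inv_injective hab)
  have hfar : ∀ j, j ≤ X.dist (g : G) (p j) ∧ j ≤ X.dist (g : G)⁻¹ (p j) := by
    intro j
    have h1 := hinj.tendsto_cofinite.eventually (hcof j)
    have h2 := hinj'.tendsto_cofinite.eventually (hcof j)
    rw [Nat.cofinite_eq_atTop] at h1 h2
    obtain ⟨n, hn, ⟨h3, h4⟩, h5, h6⟩ :=
      ((exists_le_succ_of_nat fun n => X.dist 1 ((g : G) ^ n)).and_eventually (h1.and h2)).exists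
    simp only [Subgroup.coe_inv, Subgroup.coe_pow] at h3 h4 h5 h6
    have h7 := h.connected.dist_triangle (u := (g : G)⁻¹) (v := p j) (w := (g : G) ^ n)
    have h8 := h.connected.dist_triangle (u := (g : G)) (v := p j) (w := ((g : G) ^ n)⁻¹)
    have h9 := h.dist_mul (g : G) (g : G)⁻¹ ((g : G) ^ n)
    have h10 := h.dist_mul ((g : G) ^ n) (g : G) ((g : G) ^ n)⁻¹
    have h11 := h.dist_mul ((g : G) ^ n) 1 ((g : G) ^ n)⁻¹
    rw [mul_inv_cancel, ← pow_succ'] at h9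
    rw [mul_inv_cancel, ← pow_succ, SimpleGraph.dist_comm] at h10
    rw [mul_inv_cancel, mul_one, SimpleGraph.dist_comm] at h11
    omega
  have h0 : ∀ n, X.dist 1 (p n) = n := fun n => by
    obtain ⟨x, hx⟩ := (hslice n).exists
    exact hx.1
  obtain ⟨n, h1, h2, h3⟩ := ((hb 1).and ((hb g).and (hb (g : G)⁻¹))).exists
  have h4 := hfar n
  have h5 := h0 n
  have h6 := hbf g 1
  have h7 := hbf g⁻¹ 1
  simp only [Subgroup.coe_inv, mul_one, map_inv, toAdd_inv] at h6 h7
  apply hg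
  apply hf
  rw [map_one]
  apply Multiplicative.toAdd.injective
  rw [toAdd_one]
  omega

end Ends

end KGeodetic

namespace KGeodetic

open SimpleGraph Filter

section Cuts

variable {V : Type*} {X : SimpleGraph V}

theorem mem_edgeBoundary {C : Set V} {u v : V} :
    (u, v) ∈ edgeBoundary X C ↔ X.Adj u v ∧ u ∈ C ∧ v ∉ C := Iff.rfl

theorem edgeBoundary_compl (C : Set V) :
    edgeBoundary X Cᶜ = Prod.swap '' edgeBoundary X C := by
  ext ⟨u, v⟩
  simp only [Set.image_swap_eq_preimage_swap, Set.mem_preimage, Prod.swap_prod_mk,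
    mem_edgeBoundary, Set.mem_compl_iff, not_not, X.adj_comm u v]
  tauto

theorem finite_edgeBoundary_compl {C : Set V} (h : (edgeBoundary X C).Finite) :
    (edgeBoundary X Cᶜ).Finite := by
  rw [edgeBoundary_compl]
  exact h.image _

theorem ncard_edgeBoundary_compl (C : Set V) :
    (edgeBoundary X Cᶜ).ncard = (edgeBoundary X C).ncard := by
  rw [edgeBoundary_compl, Set.ncard_image_of_injective _ Prod.swap_injective]

theorem finite_edgeBoundary_inter {C D : Set V} (hC : (edgeBoundary X C).Finite)
    (hD : (edgeBoundary X D).Finite) : (edgeBoundary X (C ∩ D)).Finite := by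
  refine (hC.union hD).subset ?_
  rintro ⟨u, v⟩
  simp only [Set.mem_union, mem_edgeBoundary, Set.mem_inter_iff]
  tauto

theorem ncard_add_ncard_le {α : Type*} {A B A' B' : Set α} (hA' : A'.Finite) (hB' : B'.Finite)
    (h1 : A ∪ B ⊆ A' ∪ B') (h2 : A ∩ B ⊆ A' ∩ B') :
    A.ncard + B.ncard ≤ A'.ncard + B'.ncard := by
  have hA := (hA'.union hB').subset (Set.subset_union_left.trans h1)
  have hB := (hA'.union hB').subset (Set.subset_union_right.trans h1)
  rw [← Set.ncard_union_add_ncard_inter A B hA hB,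
    ← Set.ncard_union_add_ncard_inter A' B' hA' hB']
  exact add_le_add (Set.ncard_le_ncard h1 (hA'.union hB'))
    (Set.ncard_le_ncard h2 (hA'.subset Set.inter_subset_left))

theorem ncard_add_ncard_lt {α : Type*} {A B A' B' : Set α} (hA' : A'.Finite) (hB' : B'.Finite)
    (h1 : A ∪ B ⊂ A' ∪ B') (h2 : A ∩ B ⊆ A' ∩ B') :
    A.ncard + B.ncard < A'.ncard + B'.ncard := by
  have hA := (hA'.union hB').subset (Set.subset_union_left.trans h1.1)
  have hB := (hA'.union hB').subset (Set.subset_union_right.trans h1.1)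
  rw [← Set.ncard_union_add_ncard_inter A B hA hB,
    ← Set.ncard_union_add_ncard_inter A' B' hA' hB']
  exact add_lt_add_of_lt_of_le (Set.ncard_lt_ncard h1 (hA'.union hB'))
    (Set.ncard_le_ncard h2 (hA'.subset Set.inter_subset_left))

theorem ncard_edgeBoundary_inter_add_le {C D : Set V} (hC : (edgeBoundary X C).Finite)
    (hD : (edgeBoundary X D).Finite) :
    (edgeBoundary X (C ∩ D)).ncard + (edgeBoundary X (Cᶜ ∩ Dᶜ)).ncard ≤
      (edgeBoundary X C).ncard + (edgeBoundary X D).ncard := by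
  rw [← Set.compl_union, ncard_edgeBoundary_compl]
  refine ncard_add_ncard_le hC hD ?_ ?_ <;> rintro ⟨u, v⟩ <;>
  · simp only [Set.mem_union, mem_edgeBoundary, Set.mem_inter_iff]
    tauto

theorem exists_mem_edgeBoundary_of_walk {C : Set V} {u v : V} (p : X.Walk u v) (hu : u ∈ C)
    (hv : v ∉ C) : ∃ d ∈ p.darts, (d.fst, d.snd) ∈ edgeBoundary X C := by
  obtain ⟨d, hd, h1, h2⟩ := p.exists_boundary_dart C hu hv
  exact ⟨d, hd, d.adj, h1, h2⟩

theorem edgeBoundary_nonempty (hX : X.Connected) {C : Set V} {u v : V} (hu : u ∈ C) (hv : v ∉ C) :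
    (edgeBoundary X C).Nonempty := by
  obtain ⟨p⟩ := hX.preconnected u v
  obtain ⟨d, -, hd⟩ := exists_mem_edgeBoundary_of_walk p hu hv
  exact ⟨_, hd⟩

/-- A set of vertices that does not split into two nonempty parts with no edges between them. -/
def Indecomposable (X : SimpleGraph V) (C : Set V) : Prop :=
  ∀ A ⊆ C, A.Nonempty → (∀ u ∈ A, ∀ v ∈ C, X.Adj u v → v ∈ A) → A = C

theorem Indecomposable.deleteEdges {C : Set V} (hC : Indecomposable X C) {u v : V}
    (h : u ∉ C ∨ v ∉ C) : Indecomposable (X.deleteEdges {s(u, v)}) C := by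
  intro A hA hne hcl
  refine hC A hA hne fun a ha b hb hab => hcl a ha b hb ?_
  rw [deleteEdges_adj]
  refine ⟨hab, fun he => ?_⟩
  have ha' := hA ha
  rcases Sym2.eq_iff.1 (Set.mem_singleton_iff.1 he) with ⟨rfl, rfl⟩ | ⟨rfl, rfl⟩ <;> tauto

theorem finite_setOf_indecomposable (n : ℕ) : ∀ (X : SimpleGraph V) (u v : V), X.Adj u v →
    {C | Indecomposable X C ∧ Indecomposable X Cᶜ ∧ u ∈ C ∧ v ∉ C ∧
      (edgeBoundary X C).Finite ∧ (edgeBoundary X C).ncard ≤ n}.Finite := by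
  induction n with
  | zero =>
    intro X u v huv
    refine Set.finite_empty.subset ?_
    rintro C ⟨-, -, hu, hv, hfin, hn⟩
    have : edgeBoundary X C = ∅ := (Set.ncard_eq_zero hfin).1 (by omega)
    have h : (u, v) ∈ edgeBoundary X C := ⟨huv, hu, hv⟩
    rw [this] at h
    exact h
  | succ n ih =>
    intro X u v huv
    set Y := X.deleteEdges {s(u, v)} with hY
    have hcl : ∀ C : Set V, Indecomposable Y C → ∀ x ∈ C, C ⊆ {y | Y.Reachable x y} := by
      intro C hC x hx y hy
      have := hC (C ∩ {y | Y.Reachable x y}) Set.inter_subset_left ⟨x, hx, Reachable.refl x⟩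
        fun a ha b hb hab => ⟨hb, ha.2.trans hab.reachable⟩
      rw [← this] at hy
      exact hy.2
    by_cases hr : Y.Reachable u v
    · obtain ⟨p⟩ := hr
      refine (p.darts.finite_toSet.biUnion fun d _ => ih Y d.fst d.snd d.adj).subset ?_
      rintro C ⟨hC, hC', hu, hv, hfin, hn⟩
      obtain ⟨d, hd, h1, h2, h3⟩ := exists_mem_edgeBoundary_of_walk p hu hv
      have hsub : edgeBoundary Y C ⊂ edgeBoundary X C := by
        refine ⟨fun e he => ⟨(deleteEdges_adj.1 he.1).1, he.2⟩, fun hs => ?_⟩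
        have h : (u, v) ∈ edgeBoundary Y C := hs ⟨huv, hu, hv⟩
        exact (deleteEdges_adj.1 h.1).2 rfl
      have := Set.ncard_lt_ncard hsub hfin
      simp only [Set.mem_iUnion]
      exact ⟨d, hd, hC.deleteEdges (Or.inr hv), hC'.deleteEdges (Or.inl (not_not.2 hu)), h2, h3,
        hfin.subset hsub.1, by omega⟩
    · refine (Set.finite_singleton {y | Y.Reachable u y}).subset ?_
      rintro C ⟨hC, hC', hu, hv, -, -⟩
      refine (hcl C (hC.deleteEdges (Or.inr hv)) u hu).antisymm fun y hy => ?_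
      by_contra hyC
      exact hr (hy.trans (hcl _ (hC'.deleteEdges (Or.inl (not_not.2 hu))) v hv hyC).symm)

/-- Two cuts are nested if one of their four corners is empty. -/
def Nested (C D : Set V) : Prop :=
  C ⊆ D ∨ C ⊆ Dᶜ ∨ Cᶜ ⊆ D ∨ Cᶜ ⊆ Dᶜ

theorem nested_comm {C D : Set V} : Nested C D ↔ Nested D C := by
  unfold Nested
  have h1 := Set.compl_subset_compl (s := C) (t := D)
  have h2 := Set.compl_subset_compl (s := D) (t := C)
  rw [Set.subset_compl_comm, Set.compl_subset_comm]
  tauto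

theorem nested_compl_left {C D : Set V} : Nested Cᶜ D ↔ Nested C D := by
  unfold Nested
  rw [compl_compl]
  tauto

theorem nested_compl_right {C D : Set V} : Nested C Dᶜ ↔ Nested C D := by
  rw [nested_comm, nested_compl_left, nested_comm]

theorem nested_inter_or {F C D : Set V} (h : Nested C F) :
    Nested (C ∩ D) F ∨ Nested (Cᶜ ∩ Dᶜ) F := by
  rcases h with h | h | h | h
  · exact Or.inl (Or.inl (Set.inter_subset_left.trans h))
  · exact Or.inl (Or.inr (Or.inl (Set.inter_subset_left.trans h)))
  · exact Or.inr (Or.inl (Set.inter_subset_left.trans h))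
  · exact Or.inr (Or.inr (Or.inl (Set.inter_subset_left.trans h)))

theorem nested_inter {F C D : Set V} (hC : Nested C F) (hD : Nested D F) (h : ¬ Nested C D) :
    Nested (C ∩ D) F := by
  unfold Nested at *
  simp only [Set.subset_def, Set.mem_inter_iff, Set.mem_compl_iff] at *
  grind

/-- A cut separates two ultrafilters if it belongs to exactly one of them. -/
def Separates (C : Set V) (ω ω' : Ultrafilter V) : Prop :=
  ¬ (C ∈ ω ↔ C ∈ ω')

theorem separates_compl {C : Set V} {ω ω' : Ultrafilter V} :
    Separates Cᶜ ω ω' ↔ Separates C ω ω' := by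
  simp only [Separates, Ultrafilter.compl_mem_iff_notMem]
  tauto

/-- A cut with the least number of boundary edges among all those separating `ω` and `ω'`. -/
def IsMinCut (X : SimpleGraph V) (C : Set V) (ω ω' : Ultrafilter V) : Prop :=
  (edgeBoundary X C).Finite ∧ Separates C ω ω' ∧ ∀ D, (edgeBoundary X D).Finite →
    Separates D ω ω' → (edgeBoundary X C).ncard ≤ (edgeBoundary X D).ncard

/-- The cuts that are minimal for some pair of ends. -/
def minCuts (X : SimpleGraph V) : Set (Set V) :=
  {C | ∃ ω ω' : Ultrafilter V, (ω : Filter V) ≤ cofinite ∧ (ω' : Filter V) ≤ cofinite ∧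
    IsMinCut X C ω ω'}

theorem IsMinCut.compl {C : Set V} {ω ω' : Ultrafilter V} (h : IsMinCut X C ω ω') :
    IsMinCut X Cᶜ ω ω' :=
  ⟨finite_edgeBoundary_compl h.1, separates_compl.2 h.2.1, by
    rw [ncard_edgeBoundary_compl]; exact h.2.2⟩

theorem compl_mem_minCuts {C : Set V} (h : C ∈ minCuts X) : Cᶜ ∈ minCuts X := by
  obtain ⟨ω, ω', h1, h2, h3⟩ := h
  exact ⟨ω, ω', h1, h2, h3.compl⟩

theorem IsMinCut.indecomposable (hX : X.Connected) {C : Set V} {ω ω' : Ultrafilter V}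
    (h : IsMinCut X C ω ω') : Indecomposable X C := by
  intro A hA ⟨a, ha⟩ hcl
  by_contra hne
  obtain ⟨c, hcC, hcA⟩ := Set.exists_of_ssubset (hA.ssubset_of_ne hne)
  have key : ∀ B ⊆ C, (∀ u ∈ B, ∀ v ∈ C, X.Adj u v → v ∈ B) → ∀ b ∈ C, b ∉ B → ∀ b' ∈ B,
      (∀ u ∈ C \ B, ∀ v ∈ C, X.Adj u v → v ∈ C \ B) → ¬ Separates B ω ω' := by
    intro B hB hBcl b hb hbB b' hb' hcl' hsep
    have h1 : edgeBoundary X B ⊂ edgeBoundary X C := by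
      refine ⟨fun e he => ⟨he.1, hB he.2.1, fun h => he.2.2 (hBcl _ he.2.1 _ h he.1)⟩, fun hs => ?_⟩
      obtain ⟨e, he⟩ := edgeBoundary_nonempty hX (C := C \ B) (u := b) (v := b') ⟨hb, hbB⟩
        fun h => h.2 hb'
      have : e ∈ edgeBoundary X C := ⟨he.1, he.2.1.1, fun h => he.2.2 (hcl' _ he.2.1 _ h he.1)⟩
      exact he.2.1.2 (hs this).2.1
    have h2 := h.2.2 B (h.1.subset h1.1) hsep
    exact absurd (Set.ncard_lt_ncard h1 h.1) (by omega)
  have hcl' : ∀ u ∈ C \ A, ∀ v ∈ C, X.Adj u v → v ∈ C \ A := fun u hu v hv huv =>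
    ⟨hv, fun hvA => hu.2 (hcl v hvA u hu.1 huv.symm)⟩
  have h1 := key A hA hcl c hcC hcA a ha hcl'
  have h2 := key (C \ A) Set.sdiff_subset hcl' a (hA ha) (fun h => h.2 ha) c ⟨hcC, hcA⟩
    (by rwa [Set.sdiff_sdiff_cancel_left hA])
  have h3 : C = A ∪ C \ A := (Set.union_sdiff_cancel hA).symm
  have h4 := h.2.1
  unfold Separates at h1 h2 h4
  rw [h3, Ultrafilter.union_mem_iff, Ultrafilter.union_mem_iff] at h4
  tauto

theorem indecomposable_of_mem_minCuts (hX : X.Connected) {C : Set V} (h : C ∈ minCuts X) :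
    Indecomposable X C := by
  obtain ⟨ω, ω', -, -, h⟩ := h
  exact h.indecomposable hX

theorem finite_edgeBoundary_of_mem_minCuts {C : Set V} (h : C ∈ minCuts X) :
    (edgeBoundary X C).Finite := by
  obtain ⟨ω, ω', -, -, h⟩ := h
  exact h.1

theorem finite_minCuts_of_adj (hX : X.Connected) {K : ℕ}
    (hK : ∀ C ∈ minCuts X, (edgeBoundary X C).ncard ≤ K) {u v : V} (huv : X.Adj u v) :
    {C ∈ minCuts X | u ∈ C ∧ v ∉ C}.Finite := by
  refine (finite_setOf_indecomposable K X u v huv).subset ?_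
  rintro C ⟨hC, hu, hv⟩
  exact ⟨indecomposable_of_mem_minCuts hX hC, indecomposable_of_mem_minCuts hX
    (compl_mem_minCuts hC), hu, hv, finite_edgeBoundary_of_mem_minCuts hC, hK C hC⟩

theorem finite_minCuts (hX : X.Connected) {K : ℕ}
    (hK : ∀ C ∈ minCuts X, (edgeBoundary X C).ncard ≤ K) (u v : V) :
    {C ∈ minCuts X | u ∈ C ∧ v ∉ C}.Finite := by
  obtain ⟨p⟩ := hX.preconnected u v
  refine (p.darts.finite_toSet.biUnion fun d _ => finite_minCuts_of_adj hX hK d.adj).subset ?_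
  rintro C ⟨hC, hu, hv⟩
  obtain ⟨d, hd, -, h2, h3⟩ := exists_mem_edgeBoundary_of_walk p hu hv
  simp only [Set.mem_iUnion]
  exact ⟨d, hd, hC, h2, h3⟩

/-- The minimal cuts that are not nested with `C`. -/
def crossing (X : SimpleGraph V) (C : Set V) : Set (Set V) :=
  {D ∈ minCuts X | ¬ Nested C D}

theorem crossing_compl (C : Set V) : crossing X Cᶜ = crossing X C := by
  simp only [crossing, nested_compl_left]

theorem finite_crossing (hX : X.Connected) {K : ℕ}
    (hK : ∀ C ∈ minCuts X, (edgeBoundary X C).ncard ≤ K) {C : Set V}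
    (hC : (edgeBoundary X C).Finite) : (crossing X C).Finite := by
  set W : Set V := Prod.fst '' edgeBoundary X C ∪ Prod.snd '' edgeBoundary X C with hWdef
  have hW : W.Finite := (hC.image _).union (hC.image _)
  have key : ∀ D ∈ minCuts X, W ⊆ Dᶜ → Nested C D := by
    intro D hD hWD
    have hcl : ∀ u ∈ D ∩ C, ∀ v ∈ D, X.Adj u v → v ∈ D ∩ C := by
      refine fun u hu v hv huv => ⟨hv, by_contra fun hvC => ?_⟩
      exact hWD (Or.inl ⟨(u, v), ⟨huv, hu.2, hvC⟩, rfl⟩) hu.1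
    by_cases hne : (D ∩ C).Nonempty
    · have := indecomposable_of_mem_minCuts hX hD _ Set.inter_subset_left hne hcl
      exact nested_comm.1 (Or.inl (Set.inter_eq_left.1 this))
    · refine nested_comm.1 (Or.inr (Or.inl fun x hx hxC => hne ⟨x, hx, hxC⟩))
  refine (hW.biUnion fun x _ => hW.biUnion fun y _ => finite_minCuts hX hK x y).subset ?_
  rintro D ⟨hD, hCD⟩
  have h1 : ¬ W ⊆ Dᶜ := fun h => hCD (key D hD h)
  have h2 : ¬ W ⊆ D := fun h =>
    hCD (nested_compl_right.1 (key Dᶜ (compl_mem_minCuts hD) (by rwa [compl_compl])))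
  obtain ⟨x, hx, hxD⟩ := Set.not_subset.1 h1
  obtain ⟨y, hy, hyD⟩ := Set.not_subset.1 h2
  simp only [Set.mem_iUnion]
  exact ⟨x, hx, y, hy, hD, not_not.1 hxD, hyD⟩

theorem ncard_crossing_inter_add_lt (hX : X.Connected) {K : ℕ}
    (hK : ∀ C ∈ minCuts X, (edgeBoundary X C).ncard ≤ K) {C D : Set V}
    (hC : C ∈ minCuts X) (hD : (edgeBoundary X D).Finite) (h : ¬ Nested C D) :
    (crossing X (C ∩ D)).ncard + (crossing X (Cᶜ ∩ Dᶜ)).ncard <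
      (crossing X C).ncard + (crossing X D).ncard := by
  have h' : ¬ Nested Cᶜ Dᶜ := by rwa [nested_compl_left, nested_compl_right]
  refine ncard_add_ncard_lt (finite_crossing hX hK (finite_edgeBoundary_of_mem_minCuts hC))
    (finite_crossing hX hK hD) ⟨?_, fun hs => ?_⟩ ?_
  · rintro F (⟨hF, hF'⟩ | ⟨hF, hF'⟩) <;> by_contra hn <;>
      simp only [crossing, Set.mem_union, Set.mem_sep_iff, hF, true_and, not_or, not_not] at hn
    · exact hF' (nested_inter hn.1 hn.2 h)
    · exact hF' (nested_inter (nested_compl_left.2 hn.1) (nested_compl_left.2 hn.2) h')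
  · rcases hs (Or.inr ⟨hC, fun hn => h (nested_comm.1 hn)⟩ : C ∈ crossing X C ∪ crossing X D) with
      hn | hn
    · exact hn.2 (Or.inl Set.inter_subset_left)
    · exact hn.2 (Or.inr (Or.inl Set.inter_subset_left))
  · rintro F ⟨⟨hF, h1⟩, -, h2⟩
    refine ⟨⟨hF, fun hn => ?_⟩, hF, fun hn => ?_⟩
    · exact (nested_inter_or hn).elim h1 h2
    · rw [Set.inter_comm] at h1 h2
      exact (nested_inter_or hn).elim h1 h2

end Cuts

end KGeodetic

namespace KGeodetic

open SimpleGraph Filter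

section OptimalCuts

variable {V : Type*} {X : SimpleGraph V}

/-- Cuts are compared first by the number of boundary edges, then by the number of minimal cuts
that they cross. -/
noncomputable def weight (X : SimpleGraph V) (C : Set V) : ℕ ×ₗ ℕ :=
  toLex ((edgeBoundary X C).ncard, (crossing X C).ncard)

theorem weight_le_weight {C D : Set V} : weight X C ≤ weight X D ↔
    (edgeBoundary X C).ncard < (edgeBoundary X D).ncard ∨
      (edgeBoundary X C).ncard = (edgeBoundary X D).ncard ∧
        (crossing X C).ncard ≤ (crossing X D).ncard :=
  Prod.Lex.toLex_le_toLex

theorem weight_compl (C : Set V) : weight X Cᶜ = weight X C := by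
  rw [weight, ncard_edgeBoundary_compl, crossing_compl, weight]

/-- A cut of least weight among all those separating `ω` and `ω'`. -/
def IsOptCut (X : SimpleGraph V) (C : Set V) (ω ω' : Ultrafilter V) : Prop :=
  (edgeBoundary X C).Finite ∧ Separates C ω ω' ∧ ∀ D, (edgeBoundary X D).Finite →
    Separates D ω ω' → weight X C ≤ weight X D

/-- The cuts that are optimal for some pair of ends. -/
def optCuts (X : SimpleGraph V) : Set (Set V) :=
  {C | ∃ ω ω' : Ultrafilter V, (ω : Filter V) ≤ cofinite ∧ (ω' : Filter V) ≤ cofinite ∧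
    IsOptCut X C ω ω'}

theorem IsOptCut.isMinCut {C : Set V} {ω ω' : Ultrafilter V} (h : IsOptCut X C ω ω') :
    IsMinCut X C ω ω' := by
  refine ⟨h.1, h.2.1, fun D hD hs => ?_⟩
  have := weight_le_weight.1 (h.2.2 D hD hs)
  omega

theorem optCuts_subset_minCuts : optCuts X ⊆ minCuts X := by
  rintro C ⟨ω, ω', h1, h2, h⟩
  exact ⟨ω, ω', h1, h2, h.isMinCut⟩

theorem compl_mem_optCuts {C : Set V} (h : C ∈ optCuts X) : Cᶜ ∈ optCuts X := by
  obtain ⟨ω, ω', h1, h2, h⟩ := h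
  exact ⟨ω, ω', h1, h2, finite_edgeBoundary_compl h.1, separates_compl.2 h.2.1, by
    rw [weight_compl]; exact h.2.2⟩

theorem exists_isOptCut {C : Set V} {ω ω' : Ultrafilter V} (hC : (edgeBoundary X C).Finite)
    (h : Separates C ω ω') : ∃ D, IsOptCut X D ω ω' := by
  have hne : {D | (edgeBoundary X D).Finite ∧ Separates D ω ω'}.Nonempty := ⟨C, hC, h⟩
  obtain ⟨D, hD, hmin⟩ := exists_minimalFor_of_wellFoundedLT _ (weight X) hne
  refine ⟨D, hD.1, hD.2, fun F hF hs => ?_⟩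
  rcases le_total (weight X D) (weight X F) with h | h
  · exact h
  · exact hmin ⟨hF, hs⟩ h

theorem nonempty_of_mem_optCuts {C : Set V} (h : C ∈ optCuts X) : C.Nonempty := by
  obtain ⟨ω, ω', -, -, h⟩ := h
  rw [Set.nonempty_iff_ne_empty]
  rintro rfl
  exact h.2.1 ⟨fun h => absurd h ω.empty_notMem, fun h => absurd h ω'.empty_notMem⟩

/-- Optimal cuts are pairwise nested. -/
theorem nested_of_mem_optCuts (hX : X.Connected) {K : ℕ}
    (hK : ∀ C ∈ minCuts X, (edgeBoundary X C).ncard ≤ K) {C D : Set V}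
    (hC : C ∈ optCuts X) (hD : D ∈ optCuts X) : Nested C D := by
  by_contra hCD
  have hCm := optCuts_subset_minCuts hC
  obtain ⟨ω₁, ω₂, -, -, hC1, hC2, hC3⟩ := hC
  obtain ⟨ω₃, ω₄, -, -, hD1, hD2, hD3⟩ := hD
  have hC1' := finite_edgeBoundary_compl hC1
  have hD1' := finite_edgeBoundary_compl hD1
  have hd1 := ncard_edgeBoundary_inter_add_le hC1 hD1
  have hd2 := ncard_edgeBoundary_inter_add_le hC1 hD1'
  have hm1 := ncard_crossing_inter_add_lt hX hK hCm hD1 hCD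
  have hm2 := ncard_crossing_inter_add_lt hX hK hCm hD1'
    (fun h => hCD (nested_compl_right.1 h))
  rw [compl_compl] at hd2 hm2
  rw [ncard_edgeBoundary_compl D] at hd2
  rw [crossing_compl D] at hm2
  simp only [weight_le_weight] at hC3 hD3
  have a1 := hC3 _ (finite_edgeBoundary_inter hC1 hD1)
  have a2 := hC3 _ (finite_edgeBoundary_inter hC1' hD1')
  have a3 := hC3 _ (finite_edgeBoundary_inter hC1 hD1')
  have a4 := hC3 _ (finite_edgeBoundary_inter hC1' hD1)
  have b1 := hD3 _ (finite_edgeBoundary_inter hC1 hD1)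
  have b2 := hD3 _ (finite_edgeBoundary_inter hC1' hD1')
  have b3 := hD3 _ (finite_edgeBoundary_inter hC1 hD1')
  have b4 := hD3 _ (finite_edgeBoundary_inter hC1' hD1)
  have c1 : ¬ (Separates (C ∩ D) ω₁ ω₂ ∧ Separates (Cᶜ ∩ Dᶜ) ω₃ ω₄) := fun h => by
    have := a1 h.1; have := b2 h.2; omega
  have c2 : ¬ (Separates (Cᶜ ∩ Dᶜ) ω₁ ω₂ ∧ Separates (C ∩ D) ω₃ ω₄) := fun h => by
    have := a2 h.1; have := b1 h.2; omega
  have c3 : ¬ (Separates (C ∩ Dᶜ) ω₁ ω₂ ∧ Separates (Cᶜ ∩ D) ω₃ ω₄) := fun h => by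
    have := a3 h.1; have := b4 h.2; omega
  have c4 : ¬ (Separates (Cᶜ ∩ D) ω₁ ω₂ ∧ Separates (C ∩ Dᶜ) ω₃ ω₄) := fun h => by
    have := a4 h.1; have := b3 h.2; omega
  have c5 : ¬ (Separates (C ∩ D) ω₁ ω₂ ∧ Separates (Cᶜ ∩ Dᶜ) ω₁ ω₂ ∧
      Separates (C ∩ Dᶜ) ω₃ ω₄ ∧ Separates (Cᶜ ∩ D) ω₃ ω₄) := fun h => by
    have := a1 h.1; have := a2 h.2.1; have := b3 h.2.2.1; have := b4 h.2.2.2; omega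
  have c6 : ¬ (Separates (C ∩ D) ω₃ ω₄ ∧ Separates (Cᶜ ∩ Dᶜ) ω₃ ω₄ ∧
      Separates (C ∩ Dᶜ) ω₁ ω₂ ∧ Separates (Cᶜ ∩ D) ω₁ ω₂) := fun h => by
    have := b1 h.1; have := b2 h.2.1; have := a3 h.2.2.1; have := a4 h.2.2.2; omega
  have hint : ∀ (A B : Set V) (ω : Ultrafilter V), A ∩ B ∈ ω ↔ A ∈ ω ∧ B ∈ ω :=
    fun A B ω => Filter.inter_mem_iff
  simp only [Separates, hint, Ultrafilter.compl_mem_iff_notMem] at hC2 hD2 c1 c2 c3 c4 c5 c6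
  clear a1 a2 a3 a4 b1 b2 b3 b4 hd1 hd2 hm1 hm2 hC3 hD3 hint
  by_cases h1 : C ∈ ω₁ <;> by_cases h2 : C ∈ ω₂ <;> by_cases h3 : C ∈ ω₃ <;>
    by_cases h4 : C ∈ ω₄ <;> by_cases h5 : D ∈ ω₁ <;> by_cases h6 : D ∈ ω₂ <;>
    by_cases h7 : D ∈ ω₃ <;> by_cases h8 : D ∈ ω₄ <;> simp_all

theorem finite_optCuts (hX : X.Connected) {K : ℕ}
    (hK : ∀ C ∈ minCuts X, (edgeBoundary X C).ncard ≤ K) (u v : V) :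
    {C ∈ optCuts X | u ∈ C ∧ v ∉ C}.Finite :=
  (finite_minCuts hX hK u v).subset fun _ h => ⟨optCuts_subset_minCuts h.1, h.2⟩

end OptimalCuts

section Invariance

open scoped Pointwise

variable {G : Type*} [Group G] {X : SimpleGraph G}

theorem IsLeftInvariant.exists_ncard_edgeBoundary_minCuts_le (h : IsLeftInvariant X) {k : ℕ}
    (hk : IsKGeodetic X k) (hX : IsHyperbolic X) :
    ∃ K, ∀ C ∈ minCuts X, (edgeBoundary X C).ncard ≤ K := by
  obtain ⟨K, hK⟩ := h.exists_subset_ncard_edgeBoundary_le hk hX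
  refine ⟨K, ?_⟩
  rintro C ⟨ω, ω', h1, h2, h3, h4, h5⟩
  unfold Separates at h4 h5
  by_cases hC : C ∈ ω
  · obtain ⟨D, hDC, hD, hfin, hle⟩ := hK ω h1 C hC h3
    have hD' : D ∉ ω' := fun hD' => h4 ⟨fun _ => mem_of_superset hD' hDC, fun _ => hC⟩
    exact (h5 D hfin (by tauto)).trans hle
  · have hC' : C ∈ ω' := by tauto
    obtain ⟨D, hDC, hD, hfin, hle⟩ := hK ω' h2 C hC' h3
    have hD' : D ∉ ω := fun hD' => hC (mem_of_superset hD' hDC)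
    exact (h5 D hfin (by tauto)).trans hle

theorem IsLeftInvariant.edgeBoundary_smul (h : IsLeftInvariant X) (g : G) (C : Set G) :
    edgeBoundary X (g • C) = Prod.map (g * ·) (g * ·) '' edgeBoundary X C := by
  ext ⟨u, v⟩
  simp only [mem_edgeBoundary, Set.mem_smul_set_iff_inv_smul_mem, smul_eq_mul, Set.mem_image,
    Prod.exists, Prod.map_apply, Prod.mk.injEq]
  constructor
  · rintro ⟨h1, h2, h3⟩
    exact ⟨g⁻¹ * u, g⁻¹ * v, ⟨(h.adj_mul _ _ _).2 h1, h2, h3⟩, by simp, by simp⟩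
  · rintro ⟨a, b, ⟨h1, h2, h3⟩, rfl, rfl⟩
    exact ⟨(h.adj_mul _ _ _).2 h1, by simpa using h2, by simpa using h3⟩

theorem IsLeftInvariant.finite_edgeBoundary_smul (h : IsLeftInvariant X) (g : G) {C : Set G}
    (hC : (edgeBoundary X C).Finite) : (edgeBoundary X (g • C)).Finite := by
  rw [h.edgeBoundary_smul]
  exact hC.image _

theorem IsLeftInvariant.ncard_edgeBoundary_smul (h : IsLeftInvariant X) (g : G) (C : Set G) :
    (edgeBoundary X (g • C)).ncard = (edgeBoundary X C).ncard := by
  rw [h.edgeBoundary_smul, Set.ncard_image_of_injective]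
  exact (mul_right_injective g).prodMap (mul_right_injective g)

theorem separates_smul {g : G} {C : Set G} {ω ω' : Ultrafilter G} :
    Separates (g • C) ω ω' ↔ Separates C (ω.map (g⁻¹ * ·)) (ω'.map (g⁻¹ * ·)) := by
  have : (g⁻¹ * ·) ⁻¹' C = g • C := by
    ext x
    simp [Set.mem_smul_set_iff_inv_smul_mem]
  simp only [Separates, Ultrafilter.mem_map, this]

theorem map_mul_le_cofinite {ω : Ultrafilter G} (h : (ω : Filter G) ≤ cofinite) (g : G) :
    ((ω.map (g * ·) : Ultrafilter G) : Filter G) ≤ cofinite :=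
  (Filter.map_mono h).trans (mul_right_injective g).tendsto_cofinite

theorem IsLeftInvariant.smul_mem_minCuts (h : IsLeftInvariant X) (g : G) {C : Set G}
    (hC : C ∈ minCuts X) : g • C ∈ minCuts X := by
  obtain ⟨ω, ω', h1, h2, h3, h4, h5⟩ := hC
  refine ⟨ω.map (g * ·), ω'.map (g * ·), map_mul_le_cofinite h1 g, map_mul_le_cofinite h2 g,
    h.finite_edgeBoundary_smul g h3, ?_, fun D hD hs => ?_⟩
  · rw [separates_smul]
    simpa [Ultrafilter.map_map, Function.comp_def] using h4
  · rw [h.ncard_edgeBoundary_smul, ← h.ncard_edgeBoundary_smul g⁻¹ D]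
    refine h5 _ (h.finite_edgeBoundary_smul _ hD) ?_
    rw [separates_smul, inv_inv]
    exact hs

theorem nested_smul {g : G} {C D : Set G} : Nested (g • C) (g • D) ↔ Nested C D := by
  simp only [Nested, ← Set.smul_set_compl, Set.smul_set_subset_smul_set_iff]

theorem IsLeftInvariant.crossing_smul (h : IsLeftInvariant X) (g : G) (C : Set G) :
    crossing X (g • C) = (g • ·) '' crossing X C := by
  ext D
  constructor
  · rintro ⟨h1, h2⟩
    refine ⟨g⁻¹ • D, ⟨h.smul_mem_minCuts _ h1, ?_⟩, smul_inv_smul g D⟩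
    rwa [← nested_smul (g := g), smul_inv_smul]
  · rintro ⟨D, ⟨h1, h2⟩, rfl⟩
    exact ⟨h.smul_mem_minCuts _ h1, by rwa [nested_smul]⟩

theorem IsLeftInvariant.weight_smul (h : IsLeftInvariant X) (g : G) (C : Set G) :
    weight X (g • C) = weight X C := by
  rw [weight, h.ncard_edgeBoundary_smul, h.crossing_smul, Set.ncard_image_of_injective, weight]
  exact MulAction.injective g

theorem IsLeftInvariant.smul_mem_optCuts (h : IsLeftInvariant X) (g : G) {C : Set G}
    (hC : C ∈ optCuts X) : g • C ∈ optCuts X := by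
  obtain ⟨ω, ω', h1, h2, h3, h4, h5⟩ := hC
  refine ⟨ω.map (g * ·), ω'.map (g * ·), map_mul_le_cofinite h1 g, map_mul_le_cofinite h2 g,
    h.finite_edgeBoundary_smul g h3, ?_, fun D hD hs => ?_⟩
  · rw [separates_smul]
    simpa [Ultrafilter.map_map, Function.comp_def] using h4
  · rw [h.weight_smul, ← h.weight_smul g⁻¹ D]
    refine h5 _ (h.finite_edgeBoundary_smul _ hD) ?_
    rw [separates_smul, inv_inv]
    exact hs

end Invariance

end KGeodetic

namespace KGeodetic

open CategoryTheory

universe u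

/-- A directed multigraph with edge set `L` in which every vertex can be reached from every other
one, and in which every assignment of group elements to the edges comes from the vertices. -/
structure IsTreeLike {V L : Type u} (s t : L → V) : Prop where
  conn : ∀ P : V → Prop, (∀ ℓ, P (s ℓ) ↔ P (t ℓ)) → ∀ v w, P v → P w
  pot : ∀ (K : Type u) [Group K] (c : L → K), ∃ φ : V → K, ∀ ℓ, φ (t ℓ) = c ℓ * φ (s ℓ)

theorem IsTreeLike.eq_of_forall {V L : Type u} {s t : L → V} (h : IsTreeLike s t) {α : Type*}
    (f : V → α) (hf : ∀ ℓ, f (t ℓ) = f (s ℓ)) (v w : V) : f v = f w :=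
  (h.conn (fun x => f x = f w) (fun ℓ => by rw [hf]) w v rfl)

/-- The objects of the fundamental groupoid of a quotient graph. -/
def OrbitGroupoid (H V : Type*) [Group H] [MulAction H V] : Type _ :=
  MulAction.orbitRel.Quotient H V

instance (H V : Type u) [Group H] [MulAction H V] : Groupoid (OrbitGroupoid H V) where
  Hom _ _ := H
  id _ := (1 : H)
  comp f g := (g * f : H)
  id_comp f := mul_one (M := H) f
  comp_id f := one_mul (M := H) f
  assoc f g h := (mul_assoc (G := H) h g f).symm
  inv f := (f⁻¹ : H)
  inv_comp f := mul_inv_cancel (G := H) f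
  comp_inv f := inv_mul_cancel (G := H) f

section FreeAction

variable {H V L : Type u} [Group H] [MulAction H V] [MulAction H L] {s t : L → V}

theorem exists_section (hfree : ∀ (h : H) (v : V), h • v = v → h = 1) :
    ∃ (r : OrbitGroupoid H V → V) (q : V → OrbitGroupoid H V) (τ : V → H),
      (∀ a, q (r a) = a) ∧ (∀ a, τ (r a) = 1) ∧ (∀ v, τ v • r (q v) = v) ∧
      (∀ (h : H) v, q (h • v) = q v) ∧ ∀ (h : H) v, τ (h • v) = h * τ v := by
  have hq : ∀ v : V, ∃ h : H, h • (Quotient.mk (MulAction.orbitRel H V) v).out = v := by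
    intro v
    have : v ∈ MulAction.orbit H (Quotient.mk (MulAction.orbitRel H V) v).out :=
      (MulAction.orbitRel_apply).1 ((MulAction.orbitRel H V).symm (Quotient.mk_out v))
    exact this
  have huniq : ∀ (h h' : H) (v : V), h • v = h' • v → h = h' := by
    intro h h' v hv
    have := hfree (h'⁻¹ * h) v (by rw [mul_smul, hv, inv_smul_smul])
    rwa [inv_mul_eq_one, eq_comm] at this
  choose τ hτ using hq
  have hsm : ∀ (h : H) (v : V), Quotient.mk (MulAction.orbitRel H V) (h • v) =
      Quotient.mk (MulAction.orbitRel H V) v := fun h v =>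
    Quotient.sound (MulAction.orbitRel_apply.2 (MulAction.mem_orbit v h))
  refine ⟨fun a => Quotient.out a, fun v => Quotient.mk (MulAction.orbitRel H V) v, τ,
    fun a => Quotient.out_eq a, fun a => ?_, hτ, hsm, fun h v => ?_⟩
  · refine hfree _ (Quotient.out a) ?_
    exact (congrArg (fun b => τ (Quotient.out a) • Quotient.out b) (Quotient.out_eq a)).symm.trans
      (hτ (Quotient.out a))
  · have h1 := hτ (h • v)
    rw [hsm] at h1
    refine huniq _ _ _ (h1.trans ?_)
    rw [mul_smul, hτ]

/-- A group acting freely on a tree is free. -/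
theorem IsTreeLike.isFreeGroup [Nonempty V] (hT : IsTreeLike s t)
    (hs : ∀ (h : H) ℓ, s (h • ℓ) = h • s ℓ) (ht : ∀ (h : H) ℓ, t (h • ℓ) = h • t ℓ)
    (hfree : ∀ (h : H) (v : V), h • v = v → h = 1) : IsFreeGroup H := by
  obtain ⟨r, q, τ, hqr, hτr, hτ, hqsm, hτsm⟩ := exists_section hfree
  have hout : ∀ ℓ : L, ∃ h : H, h • ℓ = (Quotient.mk (MulAction.orbitRel H L) ℓ).out := by
    intro ℓ
    have : (Quotient.mk (MulAction.orbitRel H L) ℓ).out ∈ MulAction.orbit H ℓ :=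
      MulAction.orbitRel_apply.1 (Quotient.mk_out ℓ)
    exact this
  let _ : IsFreeGroupoid (OrbitGroupoid H V) :=
    { quiverGenerators :=
        ⟨fun a b => {m : MulAction.orbitRel.Quotient H L // q (s m.out) = a ∧ q (t m.out) = b}⟩
      of := fun e => ((τ (t e.1.out))⁻¹ * τ (s e.1.out) : H)
      unique_lift := by
        intro K _ f
        let c : MulAction.orbitRel.Quotient H L → K := fun m => f ⟨m, rfl, rfl⟩
        obtain ⟨φ, hφ⟩ := hT.pot K fun ℓ => c (Quotient.mk _ ℓ)
        have hinv : ∀ (h : H) v w, (φ v)⁻¹ * φ (h • v) = (φ w)⁻¹ * φ (h • w) := by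
          intro h
          refine hT.eq_of_forall _ fun ℓ => ?_
          have h1 := hφ (h • ℓ)
          have h2 : (Quotient.mk (MulAction.orbitRel H L) (h • ℓ)) = Quotient.mk _ ℓ :=
            Quotient.sound (MulAction.orbitRel_apply.2 (MulAction.mem_orbit ℓ h))
          rw [hs, ht, h2] at h1
          rw [h1, hφ ℓ]
          group
        obtain ⟨v₀⟩ := ‹Nonempty V›
        let θ : H → K := fun h => (φ v₀)⁻¹ * φ (h • v₀)
        have hθ : ∀ h v, φ (h • v) = φ v * θ h := by
          intro h v
          simp only [θ]
          rw [hinv h v₀ v, mul_inv_cancel_left]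
        have hθmul : ∀ g h, θ (g * h) = θ h * θ g := by
          intro g h
          have h1 := hθ (g * h) v₀
          rw [mul_smul, hθ, hθ, mul_assoc] at h1
          exact (mul_left_cancel h1).symm
        have hθone : θ 1 = 1 := by simp [θ]
        have hφτ : ∀ v, φ v = φ (r (q v)) * θ (τ v) := fun v => by rw [← hθ, hτ]
        let F : OrbitGroupoid H V ⥤ SingleObj K :=
          { obj := fun _ => SingleObj.star K
            map := fun {a b} h => (φ (r b) * (θ h)⁻¹ * (φ (r a))⁻¹ : K)
            map_id := fun a => by
              show φ (r a) * (θ 1)⁻¹ * (φ (r a))⁻¹ = 1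
              rw [hθone]
              group
            map_comp := fun {a b d} g h => by
              show φ (r d) * (θ ((h : H) * (g : H) : H))⁻¹ * (φ (r a))⁻¹ =
                (φ (r d) * (θ h)⁻¹ * (φ (r b))⁻¹) * (φ (r b) * (θ g)⁻¹ * (φ (r a))⁻¹)
              rw [hθmul]
              group }
        refine ⟨F, ?_, ?_⟩
        · rintro a b ⟨m, rfl, rfl⟩
          show φ (r (q (t m.out))) * (θ ((τ (t m.out))⁻¹ * τ (s m.out)))⁻¹ *
            (φ (r (q (s m.out))))⁻¹ = c m
          have h1 := hφ m.out
          rw [Quotient.out_eq, hφτ, hφτ (s _)] at h1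
          have h2 := hθmul (τ (t m.out)) (τ (t m.out))⁻¹
          rw [mul_inv_cancel, hθone] at h2
          rw [hθmul, eq_inv_of_mul_eq_one_left h2.symm, mul_inv_rev, inv_inv, ← mul_assoc, h1]
          group
        · intro F' hF'
          have hobj : ∀ a, F'.obj a = F.obj a := fun a => Subsingleton.elim (α := PUnit) _ _
          let A : OrbitGroupoid H V → OrbitGroupoid H V → H → K := fun a b h =>
            F'.map (X := a) (Y := b) h
          have hA : ∀ a b d g h, A a d (h * g) = A b d h * A a b g := fun a b d g h =>
            F'.map_comp (X := a) (Y := b) (Z := d) g h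
          have hA1 : ∀ a, A a a 1 = 1 := fun a => F'.map_id a
          have hAgen : ∀ m : MulAction.orbitRel.Quotient H L,
              A (q (s m.out)) (q (t m.out)) ((τ (t m.out))⁻¹ * τ (s m.out)) = c m :=
            fun m => hF' _ _ ⟨m, rfl, rfl⟩
          have hAℓ : ∀ ℓ : L, A (q (s ℓ)) (q (t ℓ)) ((τ (t ℓ))⁻¹ * τ (s ℓ)) =
              c (Quotient.mk _ ℓ) := by
            intro ℓ
            obtain ⟨h, hh⟩ := hout ℓ
            have := hAgen (Quotient.mk _ ℓ)
            rw [← hh, hs, ht, hqsm, hqsm, hτsm, hτsm] at this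
            rw [← this]
            congr 1
            group
          have hAv : ∀ v w, A (q v) (q w) ((τ w)⁻¹ * τ v) = φ w * (φ v)⁻¹ := by
            intro v w
            have := hT.eq_of_forall (fun w => (φ w)⁻¹ * A (q v) (q w) ((τ w)⁻¹ * τ v))
              (fun ℓ => by
                have h1 := hA (q v) (q (s ℓ)) (q (t ℓ)) ((τ (s ℓ))⁻¹ * τ v)
                  ((τ (t ℓ))⁻¹ * τ (s ℓ))
                rw [hAℓ, ← mul_assoc, mul_inv_cancel_right] at h1
                rw [h1, hφ ℓ]
                group) w v
            simp only [inv_mul_cancel, hA1, mul_one] at this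
            rw [← this, mul_inv_cancel_left]
          have hAF : ∀ a b h, A a b h = φ (r b) * (θ h)⁻¹ * (φ (r a))⁻¹ := by
            intro a b h
            have h1 := hAv (h • r a) (r b)
            rw [hqsm, hqr, hqr, hτr, hτsm, hτr, hθ] at h1
            simpa [mul_assoc] using h1
          refine CategoryTheory.Functor.hext hobj fun a b h => ?_
          exact heq_of_eq (hAF a b h) }
  have : Nonempty (OrbitGroupoid H V) := ‹Nonempty V›.map q
  have : IsConnected (OrbitGroupoid H V) :=
    IsConnected.of_constant_of_preserves_morphisms fun F hF j j' =>
      hF (show j ⟶ j' from (1 : H))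
  obtain ⟨v₀⟩ := ‹Nonempty V›
  let e : End (q v₀) ≃* H :=
    { toFun := fun h => h
      invFun := fun h => h
      left_inv := fun _ => rfl
      right_inv := fun _ => rfl
      map_mul' := fun _ _ => rfl }
  exact IsFreeGroup.ofMulEquiv e

end FreeAction

end KGeodetic

namespace KGeodetic

open Equiv

universe u

section Representations

variable {A F : Type*} [Group A]

theorem exists_free_representation [Finite A] [Finite F] (h : Nat.card A ∣ Nat.card F) :
    ∃ ρ : A →* Perm F, ∀ a, a ≠ 1 → ∀ x, ρ a x ≠ x := by
  obtain ⟨m, hm⟩ := h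
  have : Nat.card F = Nat.card (A × Fin m) := by rw [hm, Nat.card_prod, Nat.card_fin]
  obtain ⟨e⟩ := Finite.card_eq.1 this
  refine ⟨{ toFun := fun a => (e.trans ((Equiv.mulLeft a).prodCongr (Equiv.refl _))).trans e.symm
            map_one' := by ext x; simp
            map_mul' := fun a b => by ext x; simp [mul_assoc]; rfl }, fun a ha x hx => ha ?_⟩
  have := congrArg (fun y => (e y).1) hx
  simpa using this

/-- A free representation is a disjoint union of copies of the regular representation. -/
theorem exists_equiv_of_free [Finite A] [Finite F] {ρ : A →* Perm F}
    (hρ : ∀ a, a ≠ 1 → ∀ x, ρ a x ≠ x) :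
    ∃ e : A × Fin (Nat.card F / Nat.card A) ≃ F, ∀ a b i, e (a * b, i) = ρ a (e (b, i)) := by
  let r : Setoid F :=
    { r := fun x y => ∃ a, ρ a x = y
      iseqv := ⟨fun x => ⟨1, by simp⟩, fun {x y} ⟨a, ha⟩ => ⟨a⁻¹, by rw [← ha]; simp⟩,
        fun {x y z} ⟨a, ha⟩ ⟨b, hb⟩ => ⟨b * a, by simp [ha, hb]⟩⟩ }
  let e₀ : A × Quotient r → F := fun p => ρ p.1 p.2.out
  have he₀ : Function.Bijective e₀ := by
    refine ⟨?_, fun x => ?_⟩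
    · rintro ⟨a, i⟩ ⟨b, j⟩ hab
      have hab' : ρ a i.out = ρ b j.out := hab
      have hij : i = j := by
        rw [← i.out_eq, ← j.out_eq]
        refine Quotient.sound ⟨b⁻¹ * a, ?_⟩
        simp [hab']
      subst hij
      have : b⁻¹ * a = 1 := by
        by_contra hne
        refine hρ _ hne i.out ?_
        simp [hab']
      rw [inv_mul_eq_one] at this
      rw [this]
    · obtain ⟨a, ha⟩ := Quotient.mk_out (s := r) x
      exact ⟨(a, Quotient.mk r x), ha⟩
  have hcard : Nat.card (Quotient r) = Nat.card F / Nat.card A := by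
    rw [← Nat.card_congr (Equiv.ofBijective e₀ he₀), Nat.card_prod,
      Nat.mul_div_cancel_left _ Nat.card_pos]
  have e₁ : Quotient r ≃ Fin (Nat.card F / Nat.card A) := by
    rw [← hcard]
    exact Finite.equivFin _
  refine ⟨((Equiv.refl A).prodCongr e₁.symm).trans (Equiv.ofBijective e₀ he₀), fun a b i => ?_⟩
  simp [e₀]

theorem exists_intertwiner [Finite A] [Finite F] {ρ ρ' : A →* Perm F}
    (hρ : ∀ a, a ≠ 1 → ∀ x, ρ a x ≠ x) (hρ' : ∀ a, a ≠ 1 → ∀ x, ρ' a x ≠ x) :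
    ∃ σ : Perm F, ∀ a, σ * ρ a = ρ' a * σ := by
  obtain ⟨e, he⟩ := exists_equiv_of_free hρ
  obtain ⟨e', he'⟩ := exists_equiv_of_free hρ'
  refine ⟨e.symm.trans e', fun a => ?_⟩
  ext x
  obtain ⟨⟨b, i⟩, rfl⟩ := e.surjective x
  simp only [Perm.coe_mul, Function.comp_apply, Equiv.trans_apply, Equiv.symm_apply_apply]
  rw [← he, ← he', Equiv.symm_apply_apply]

end Representations

section Cocycles

variable {G V L : Type*} [Group G] [MulAction G V] [MulAction G L] {F : Type*} [Finite F]

theorem exists_orbit_transversal (G V : Type*) [Group G] [MulAction G V] :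
    ∃ (r : V → V) (γ : V → G), (∀ v, γ v • r v = v) ∧ ∀ (g : G) v, r (g • v) = r v := by
  have hq : ∀ v : V, ∃ h : G, h • (Quotient.mk (MulAction.orbitRel G V) v).out = v := by
    intro v
    have : v ∈ MulAction.orbit G (Quotient.mk (MulAction.orbitRel G V) v).out :=
      (MulAction.orbitRel_apply).1 ((MulAction.orbitRel G V).symm (Quotient.mk_out v))
    exact this
  choose γ hγ using hq
  refine ⟨_, γ, hγ, fun g v => ?_⟩
  have : Quotient.mk (MulAction.orbitRel G V) (g • v) = Quotient.mk _ v :=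
    Quotient.sound (MulAction.orbitRel_apply.2 (MulAction.mem_orbit v g))
  rw [this]

theorem exists_cocycle (hfin : ∀ v : V, Finite (MulAction.stabilizer G v))
    (hdvd : ∀ v : V, Nat.card (MulAction.stabilizer G v) ∣ Nat.card F) :
    ∃ a : G → V → Perm F, (∀ g h v, a (g * h) v = a g (h • v) * a h v) ∧
      ∀ g v, g • v = v → g ≠ 1 → ∀ x, a g v x ≠ x := by
  classical
  choose ρ hρ using fun v : V => exists_free_representation (F := F) (hdvd v)
  let ρ' : V → G → Perm F := fun v g => if h : g • v = v then ρ v ⟨g, h⟩ else 1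
  have hmul : ∀ v g h, g • v = v → h • v = v → ρ' v (g * h) = ρ' v g * ρ' v h := by
    intro v g h hg hh
    have hgh : (g * h) • v = v := by rw [mul_smul, hh, hg]
    simp only [ρ', hg, hh, hgh, dif_pos, ← map_mul]
    rfl
  obtain ⟨r, γ, hγ, hr⟩ := exists_orbit_transversal G V
  have hη : ∀ g v, ((γ (g • v))⁻¹ * g * γ v) • r v = r v := by
    intro g v
    rw [mul_smul, hγ, mul_smul, inv_smul_eq_iff, ← hr g v, hγ]
  refine ⟨fun g v => ρ' (r v) ((γ (g • v))⁻¹ * g * γ v), fun g h v => ?_, fun g v hg hg1 => ?_⟩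
  · have h1 := hη g (h • v)
    rw [hr] at h1
    beta_reduce
    rw [hr, ← hmul _ _ _ h1 (hη h v), mul_smul]
    congr 1
    group
  · have h1 := hη g v
    rw [hg] at h1
    simp only [ρ', hg, h1, dif_pos]
    refine hρ _ _ fun hc => hg1 ?_
    have hc' : (γ v)⁻¹ * g * γ v = 1 := congrArg Subtype.val hc
    rwa [mul_assoc, inv_mul_eq_one, eq_comm, mul_eq_right] at hc'

theorem exists_intertwining_cocycle {s t : L → V} (hs : ∀ (g : G) ℓ, s (g • ℓ) = g • s ℓ)
    (ht : ∀ (g : G) ℓ, t (g • ℓ) = g • t ℓ)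
    (hfin : ∀ v : V, Finite (MulAction.stabilizer G v)) {a : G → V → Perm F}
    (ha : ∀ g h v, a (g * h) v = a g (h • v) * a h v)
    (hfree : ∀ g v, g • v = v → g ≠ 1 → ∀ x, a g v x ≠ x) :
    ∃ c : L → Perm F, ∀ (g : G) ℓ, c (g • ℓ) * a g (s ℓ) = a g (t ℓ) * c ℓ := by
  have ha1 : ∀ v, a 1 v = 1 := by
    intro v
    have := ha 1 1 v
    rwa [one_smul, mul_one, left_eq_mul] at this
  have hfix : ∀ (u : L → V), (∀ (g : G) ℓ, u (g • ℓ) = g • u ℓ) → ∀ ℓ,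
      ∀ g ∈ MulAction.stabilizer G ℓ, g • u ℓ = u ℓ := by
    intro u hu ℓ g hg
    rw [← hu, MulAction.mem_stabilizer_iff.1 hg]
  let rep : ∀ (u : L → V), (∀ (g : G) ℓ, u (g • ℓ) = g • u ℓ) → ∀ ℓ,
      MulAction.stabilizer G ℓ →* Perm F := fun u hu ℓ =>
    { toFun := fun g => a g (u ℓ)
      map_one' := ha1 _
      map_mul' := fun g h => by
        have := ha g h (u ℓ)
        rwa [hfix u hu ℓ h h.2] at this }
  have hrep : ∀ (u : L → V) (hu : ∀ (g : G) ℓ, u (g • ℓ) = g • u ℓ) (ℓ : L)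
      (g : MulAction.stabilizer G ℓ), g ≠ 1 → ∀ x, rep u hu ℓ g x ≠ x := by
    intro u hu ℓ g hg
    exact hfree _ _ (hfix u hu ℓ g g.2) fun h => hg (Subtype.ext h)
  have hfinL : ∀ ℓ : L, Finite (MulAction.stabilizer G ℓ) := by
    intro ℓ
    have := hfin (s ℓ)
    exact Finite.of_injective
      (Subgroup.inclusion (K := MulAction.stabilizer G (s ℓ)) fun g hg => hfix s hs ℓ g hg)
      (Subgroup.inclusion_injective _)
  choose c₀ hc₀ using fun ℓ => exists_intertwiner (hrep s hs ℓ) (hrep t ht ℓ)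
  obtain ⟨r, γ, hγ, hr⟩ := exists_orbit_transversal G L
  refine ⟨fun ℓ => a (γ ℓ) (t (r ℓ)) * c₀ (r ℓ) * (a (γ ℓ) (s (r ℓ)))⁻¹, fun g ℓ => ?_⟩
  have hη : ((γ (g • ℓ))⁻¹ * g * γ ℓ) • r ℓ = r ℓ := by
    rw [mul_smul, hγ, mul_smul, inv_smul_eq_iff, ← hr g ℓ, hγ]
  have key : ∀ (u : L → V), (∀ (g : G) ℓ, u (g • ℓ) = g • u ℓ) →
      a g (u ℓ) * a (γ ℓ) (u (r ℓ)) =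
        a (γ (g • ℓ)) (u (r ℓ)) * a ((γ (g • ℓ))⁻¹ * g * γ ℓ) (u (r ℓ)) := by
    intro u hu
    have h1 := ha g (γ ℓ) (u (r ℓ))
    have h2 := ha (γ (g • ℓ)) ((γ (g • ℓ))⁻¹ * g * γ ℓ) (u (r ℓ))
    rw [← hu, hγ] at h1
    rw [← hu, hη] at h2
    rw [← h1, ← h2]
    congr 1
    group
  have h0 : c₀ (r ℓ) * a ((γ (g • ℓ))⁻¹ * g * γ ℓ) (s (r ℓ)) =
      a ((γ (g • ℓ))⁻¹ * g * γ ℓ) (t (r ℓ)) * c₀ (r ℓ) :=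
    hc₀ (r ℓ) ⟨(γ (g • ℓ))⁻¹ * g * γ ℓ, hη⟩
  beta_reduce
  rw [hr, ← mul_assoc, ← mul_assoc, key t ht, mul_assoc _ (a _ (t (r ℓ))) (c₀ (r ℓ)), ← h0,
    eq_mul_inv_iff_mul_eq, mul_assoc _ (a g (s ℓ)), key s hs]
  group

end Cocycles

section VirtuallyFree

variable {G V L : Type u} [Group G] [MulAction G V] [MulAction G L] {s t : L → V}

/-- A group acting on a tree with finite stabilisers of bounded order is virtually free. -/
theorem IsTreeLike.exists_isFreeGroup [Nonempty V] (hT : IsTreeLike s t)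
    (hs : ∀ (g : G) ℓ, s (g • ℓ) = g • s ℓ) (ht : ∀ (g : G) ℓ, t (g • ℓ) = g • t ℓ)
    (hfin : ∀ v : V, Finite (MulAction.stabilizer G v)) {N : ℕ} (hN : 0 < N)
    (hdvd : ∀ v : V, Nat.card (MulAction.stabilizer G v) ∣ N) :
    ∃ H : Subgroup G, H.FiniteIndex ∧ IsFreeGroup H := by
  let F := ULift.{u} (Fin N)
  have hF : Nat.card F = N := by simp [F]
  have x₀ : F := ⟨⟨0, hN⟩⟩
  obtain ⟨a, ha, hfree⟩ := exists_cocycle (F := F) hfin (by rwa [hF])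
  obtain ⟨c, hc⟩ := exists_intertwining_cocycle hs ht hfin ha hfree
  obtain ⟨φ, hφ⟩ := hT.pot (Perm F) c
  have hconst : ∀ g v w, (φ (g • v))⁻¹ * a g v * φ v = (φ (g • w))⁻¹ * a g w * φ w := by
    intro g
    refine hT.eq_of_forall _ fun ℓ => ?_
    rw [← ht, hφ, hφ, ← mul_assoc, mul_assoc _ (a g (t ℓ)) (c ℓ), ← hc, hs]
    group
  obtain ⟨v₀⟩ := ‹Nonempty V›
  let ρ : G →* Perm F :=
    MonoidHom.mk' (fun g => (φ (g • v₀))⁻¹ * a g v₀ * φ v₀) fun g h => by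
      rw [hconst g v₀ (h • v₀), ha, mul_smul]
      group
  refine ⟨ρ.ker, Subgroup.finiteIndex_ker ρ, ?_⟩
  have : Nonempty V := ⟨v₀⟩
  refine hT.isFreeGroup (H := ρ.ker) (fun h ℓ => hs h ℓ) (fun h ℓ => ht h ℓ) fun h v hv => ?_
  by_contra hne
  have hv' : (h : G) • v = v := hv
  have h1 : (φ ((h : G) • v₀))⁻¹ * a h v₀ * φ v₀ = 1 := h.2
  rw [hconst h v₀ v, hv', mul_assoc, inv_mul_eq_one, eq_comm, mul_eq_right] at h1
  refine hfree h v hv' (fun hc => hne (Subtype.ext hc)) x₀ ?_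
  rw [h1]
  rfl

end VirtuallyFree

end KGeodetic

namespace KGeodetic

universe u

section TreeSets

variable {V : Type u} {𝓔 : Set (Set V)}

/-- A family of pairwise nested subsets, closed under complements, finitely many of which separate
any two given points. -/
structure IsTreeSet (𝓔 : Set (Set V)) : Prop where
  compl_mem : ∀ {C}, C ∈ 𝓔 → Cᶜ ∈ 𝓔
  nonempty : ∀ {C}, C ∈ 𝓔 → C.Nonempty
  nested : ∀ {C D}, C ∈ 𝓔 → D ∈ 𝓔 → Nested C D
  finite : ∀ u v, {C ∈ 𝓔 | u ∈ C ∧ v ∉ C}.Finite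

/-- The vertex of the structure tree at which the oriented edge `C` starts, as the set of oriented
edges pointing towards it. -/
def source (𝓔 : Set (Set V)) (C : Set V) : Set (Set V) :=
  {D ∈ 𝓔 | C ⊆ D ∨ (Cᶜ ⊆ D ∧ D ≠ Cᶜ)}

theorem mem_source_self {C : Set V} (hC : C ∈ 𝓔) : C ∈ source 𝓔 C :=
  ⟨hC, Or.inl subset_rfl⟩

theorem IsTreeSet.compl_mem_source (h : IsTreeSet 𝓔) {C D : Set V} (hC : C ∈ 𝓔) (hD : D ∈ 𝓔) :
    Dᶜ ∈ source 𝓔 C ↔ D ∉ source 𝓔 C := by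
  obtain ⟨x, hx⟩ := h.nonempty hC
  obtain ⟨y, hy⟩ := h.nonempty (h.compl_mem hC)
  constructor
  · rintro ⟨-, h1 | ⟨h1, h1'⟩⟩ ⟨-, h2 | ⟨h2, h2'⟩⟩
    · exact h1 hx (h2 hx)
    · exact h2' (subset_antisymm (Set.subset_compl_comm.1 h1) h2)
    · exact h1' (subset_antisymm (Set.compl_subset_compl.2 h2) h1)
    · exact h1 hy (h2 hy)
  · intro hn
    have h1 : ¬ C ⊆ D := fun h1 => hn ⟨hD, Or.inl h1⟩
    have h2 : Cᶜ ⊆ D → D = Cᶜ := fun h2 => by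
      by_contra h3
      exact hn ⟨hD, Or.inr ⟨h2, h3⟩⟩
    refine ⟨h.compl_mem hD, ?_⟩
    rcases h.nested hC hD with h3 | h3 | h3 | h3
    · exact absurd h3 h1
    · exact Or.inl h3
    · rw [h2 h3, compl_compl]
      exact Or.inl subset_rfl
    · refine Or.inr ⟨h3, fun h4 => h1 ?_⟩
      rw [compl_inj_iff.1 h4]

theorem mem_source_of_subset {C D F : Set V} (hD : D ∈ source 𝓔 C) (hF : F ∈ 𝓔) (hDF : D ⊆ F) :
    F ∈ source 𝓔 C := by
  refine ⟨hF, ?_⟩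
  rcases hD.2 with h1 | ⟨h1, h2⟩
  · exact Or.inl (h1.trans hDF)
  · refine Or.inr ⟨h1.trans hDF, ?_⟩
    rintro rfl
    exact h2 (subset_antisymm hDF h1)

theorem IsTreeSet.source_eq_of_subset (h : IsTreeSet 𝓔) {C D : Set V} (hC : C ∈ 𝓔) (hD : D ∈ 𝓔)
    (hCD : source 𝓔 C ⊆ source 𝓔 D) : source 𝓔 C = source 𝓔 D := by
  refine subset_antisymm hCD fun F hF => ?_
  by_contra hn
  rw [← h.compl_mem_source hC hF.1] at hn
  exact (h.compl_mem_source hD hF.1).1 (hCD hn) hF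

theorem IsTreeSet.finite_source (h : IsTreeSet 𝓔) (x : V) {C : Set V} (hC : C ∈ 𝓔) :
    {D ∈ source 𝓔 C | x ∉ D}.Finite := by
  obtain ⟨y, hy⟩ := h.nonempty hC
  obtain ⟨z, hz⟩ := h.nonempty (h.compl_mem hC)
  refine ((h.finite y x).union (h.finite z x)).subset ?_
  rintro D ⟨⟨hD, h1 | ⟨h1, -⟩⟩, hx⟩
  · exact Or.inl ⟨hD, h1 hy, hx⟩
  · exact Or.inr ⟨hD, h1 hz, hx⟩

theorem IsTreeSet.mem_source_compl (h : IsTreeSet 𝓔) {C D : Set V} (hC : C ∈ 𝓔) :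
    D ∈ source 𝓔 Cᶜ ↔ (D ∈ source 𝓔 C ∧ D ≠ C) ∨ D = Cᶜ := by
  obtain ⟨y, hy⟩ := h.nonempty (h.compl_mem hC)
  constructor
  · rintro ⟨hD, h1 | ⟨h1, h2⟩⟩
    · by_cases h3 : D = Cᶜ
      · exact Or.inr h3
      · refine Or.inl ⟨⟨hD, Or.inr ⟨h1, h3⟩⟩, ?_⟩
        rintro rfl
        exact hy (h1 hy)
    · rw [compl_compl] at h1 h2
      exact Or.inl ⟨⟨hD, Or.inl h1⟩, h2⟩
  · rintro (⟨⟨hD, h1 | ⟨h1, -⟩⟩, h2⟩ | rfl)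
    · exact ⟨hD, Or.inr (by rw [compl_compl]; exact ⟨h1, h2⟩)⟩
    · exact ⟨hD, Or.inl h1⟩
    · exact mem_source_self (h.compl_mem hC)

/-- The distance of a vertex of the structure tree from the vertex determined by `x`. -/
noncomputable def depth (x : V) (σ : Set (Set V)) : ℕ :=
  {D ∈ σ | x ∉ D}.ncard

theorem IsTreeSet.depth_source (h : IsTreeSet 𝓔) {x : V} {C : Set V} (hC : C ∈ 𝓔) (hx : x ∉ C) :
    depth x (source 𝓔 C) = depth x (source 𝓔 Cᶜ) + 1 := by
  have hmem : C ∈ {D ∈ source 𝓔 C | x ∉ D} := ⟨mem_source_self hC, hx⟩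
  have : {D ∈ source 𝓔 Cᶜ | x ∉ D} = {D ∈ source 𝓔 C | x ∉ D} \ {C} := by
    ext D
    constructor
    · rintro ⟨h1, h2⟩
      rcases (h.mem_source_compl hC).1 h1 with h3 | rfl
      · exact ⟨⟨h3.1, h2⟩, h3.2⟩
      · exact absurd hx h2
    · rintro ⟨⟨h1, h2⟩, h3⟩
      exact ⟨(h.mem_source_compl hC).2 (Or.inl ⟨h1, h3⟩), h2⟩
  rw [depth, depth, this, Set.ncard_sdiff_singleton_add_one hmem (h.finite_source x hC)]

theorem eq_of_source_eq {x : V} {C D : Set V} (hC : C ∈ 𝓔) (hD : D ∈ 𝓔) (hxC : x ∉ C) (hxD : x ∉ D)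
    (hCD : source 𝓔 C = source 𝓔 D) : C = D := by
  have key : ∀ {C D : Set V}, C ∈ source 𝓔 D → x ∉ C → x ∉ D → D ⊆ C := by
    rintro C D ⟨-, h1 | ⟨h1, -⟩⟩ h2 h3
    · exact h1
    · exact absurd (h1 h3) h2
  refine subset_antisymm (key ?_ hxD hxC) (key ?_ hxC hxD)
  · rw [hCD]
    exact mem_source_self hD
  · rw [← hCD]
    exact mem_source_self hC

theorem IsTreeSet.exists_source_eq (h : IsTreeSet 𝓔) {x : V} {C : Set V} (hC : C ∈ 𝓔)
    (hd : depth x (source 𝓔 C) ≠ 0) : ∃ E ∈ 𝓔, x ∉ E ∧ source 𝓔 E = source 𝓔 C := by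
  have hfin := h.finite_source x hC
  have hne := Set.nonempty_of_ncard_ne_zero hd
  obtain ⟨E, hE⟩ := hfin.exists_minimal hne
  have hE1 := hE.prop
  refine ⟨E, hE1.1.1, hE1.2, h.source_eq_of_subset hE1.1.1 hC ?_⟩
  rintro D ⟨hD, h1 | ⟨h1, h2⟩⟩
  · exact mem_source_of_subset hE1.1 hD h1
  · by_contra hn
    rw [← h.compl_mem_source hC hD] at hn
    have h3 : Dᶜ ⊆ E := Set.compl_subset_comm.1 h1
    have h4 : E ⊆ Dᶜ := hE.le_of_le ⟨hn, fun hx => hE1.2 (h3 hx)⟩ h3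
    exact h2 (by rw [subset_antisymm h4 h3, compl_compl])

theorem IsTreeSet.source_eq_of_depth_eq_zero (h : IsTreeSet 𝓔) {x : V} {C D : Set V} (hC : C ∈ 𝓔)
    (hD : D ∈ 𝓔) (hC0 : depth x (source 𝓔 C) = 0) (hD0 : depth x (source 𝓔 D) = 0) :
    source 𝓔 C = source 𝓔 D := by
  have key : ∀ {C}, C ∈ 𝓔 → depth x (source 𝓔 C) = 0 → ∀ F ∈ source 𝓔 C, x ∈ F := by
    intro C hC h0 F hF
    rw [depth, Set.ncard_eq_zero (h.finite_source x hC)] at h0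
    by_contra hx
    have : F ∈ {D ∈ source 𝓔 C | x ∉ D} := ⟨hF, hx⟩
    rw [h0] at this
    exact this
  refine h.source_eq_of_subset hC hD fun F hF => ?_
  by_contra hn
  rw [← h.compl_mem_source hD hF.1] at hn
  exact key hD hD0 _ hn (key hC hC0 _ hF)

open Classical in
/-- The potential of a vertex at distance `n` from the root. -/
noncomputable def potential (𝓔 : Set (Set V)) (x : V) {K : Type*} [Group K] (b : Set V → K) :
    ℕ → Set (Set V) → K
  | 0, _ => 1
  | n + 1, σ => if h : ∃ E ∈ 𝓔, x ∉ E ∧ source 𝓔 E = σ then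
      b h.choose * potential 𝓔 x b n (source 𝓔 h.chooseᶜ) else 1

theorem potential_succ {x : V} {K : Type*} [Group K] (b : Set V → K) {C : Set V} (hC : C ∈ 𝓔)
    (hx : x ∉ C) (n : ℕ) : potential 𝓔 x b (n + 1) (source 𝓔 C) =
      b C * potential 𝓔 x b n (source 𝓔 Cᶜ) := by
  have h : ∃ E ∈ 𝓔, x ∉ E ∧ source 𝓔 E = source 𝓔 C := ⟨C, hC, hx, rfl⟩
  have hs := h.choose_spec
  have : h.choose = C := eq_of_source_eq hs.1 hC hs.2.1 hx hs.2.2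
  rw [potential, dif_pos h, this]

theorem IsTreeSet.exists_potential (h : IsTreeSet 𝓔) {K : Type*} [Group K] (c : Set V → K) :
    ∃ ψ : Set (Set V) → K, ∀ C ∈ 𝓔,
      c Cᶜ * ψ (source 𝓔 Cᶜ) = c C * ψ (source 𝓔 C) := by
  rcases isEmpty_or_nonempty V with hV | ⟨⟨x⟩⟩
  · exact ⟨fun _ => 1, fun C hC => (hV.false (h.nonempty hC).some).elim⟩
  refine ⟨fun σ => potential 𝓔 x (fun C => (c C)⁻¹ * c Cᶜ) (depth x σ) σ, ?_⟩
  have key : ∀ C ∈ 𝓔, x ∉ C →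
      c Cᶜ * potential 𝓔 x (fun C => (c C)⁻¹ * c Cᶜ) (depth x (source 𝓔 Cᶜ)) (source 𝓔 Cᶜ) =
      c C * potential 𝓔 x (fun C => (c C)⁻¹ * c Cᶜ) (depth x (source 𝓔 C)) (source 𝓔 C) := by
    intro C hC hx
    rw [h.depth_source hC hx, potential_succ _ hC hx]
    group
  intro C hC
  by_cases hx : x ∈ C
  · have := key Cᶜ (h.compl_mem hC) (fun h => h hx)
    rw [compl_compl] at this
    exact this.symm
  · exact key C hC hx

/-- The two orientations of an edge of the structure tree. -/
def orientations (C : Set V) : Set (Set V) := {C, Cᶜ}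

theorem orientations_compl (C : Set V) : orientations Cᶜ = orientations C := by
  rw [orientations, compl_compl, Set.pair_comm, orientations]

theorem orientations_eq {C D : Set V} (h : orientations C = orientations D) : C = D ∨ C = Dᶜ := by
  have : C ∈ orientations C := Or.inl rfl
  rw [h] at this
  exact this

/-- The barycentric subdivision of the structure tree is a tree. -/
theorem IsTreeSet.isTreeLike (h : IsTreeSet 𝓔) :
    IsTreeLike (V := (source 𝓔 '' 𝓔 : Set _) ⊕ (orientations '' 𝓔 : Set _))
      (fun C : 𝓔 => Sum.inl ⟨source 𝓔 C, Set.mem_image_of_mem _ C.2⟩)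
      (fun C : 𝓔 => Sum.inr ⟨orientations (C : Set V), Set.mem_image_of_mem _ C.2⟩) where
  conn P hP := by
    let Q : 𝓔 → Prop := fun C => P (Sum.inl ⟨source 𝓔 C, Set.mem_image_of_mem _ C.2⟩)
    have hQs : ∀ C D : 𝓔, source 𝓔 C = source 𝓔 D → (Q C ↔ Q D) := by
      intro C D hCD
      simp only [Q, hCD]
    have hQc : ∀ C : 𝓔, Q C ↔ Q ⟨(C : Set V)ᶜ, h.compl_mem C.2⟩ := by
      intro C
      refine (hP C).trans (Iff.trans ?_ (hP ⟨_, h.compl_mem C.2⟩).symm)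
      simp only [orientations_compl]
    have hQ : ∀ C D, Q C ↔ Q D := by
      intro C D
      obtain ⟨x, -⟩ := h.nonempty C.2
      have key : ∀ n, ∀ C : 𝓔, depth x (source 𝓔 C) = n →
          ∃ E : 𝓔, depth x (source 𝓔 E) = 0 ∧ (Q C ↔ Q E) := by
        intro n
        induction n with
        | zero => exact fun C hC => ⟨C, hC, Iff.rfl⟩
        | succ n ih =>
          intro C hC
          obtain ⟨E, hE, hx, hEC⟩ := h.exists_source_eq (x := x) C.2 (by omega)
          have hd := h.depth_source hE hx
          rw [hEC] at hd
          obtain ⟨F, hF, hF'⟩ := ih ⟨Eᶜ, h.compl_mem hE⟩ (by show depth x (source 𝓔 Eᶜ) = n; omega)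
          exact ⟨F, hF, (hQs C ⟨E, hE⟩ hEC.symm).trans ((hQc _).trans hF')⟩
      obtain ⟨E, hE, hCE⟩ := key _ C rfl
      obtain ⟨F, hF, hDF⟩ := key _ D rfl
      rw [hCE, hDF]
      exact hQs _ _ (h.source_eq_of_depth_eq_zero E.2 F.2 hE hF)
    have hPQ : ∀ v, ∃ C, P v ↔ Q C := by
      rintro (⟨-, C, hC, rfl⟩ | ⟨-, C, hC, rfl⟩)
      · exact ⟨⟨C, hC⟩, Iff.rfl⟩
      · exact ⟨⟨C, hC⟩, (hP ⟨C, hC⟩).symm⟩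
    intro v w hv
    obtain ⟨C, hC⟩ := hPQ v
    obtain ⟨D, hD⟩ := hPQ w
    exact hD.2 ((hQ C D).1 (hC.1 hv))
  pot K _ c := by
    classical
    let c' : Set V → K := fun C => if hC : C ∈ 𝓔 then c ⟨C, hC⟩ else 1
    obtain ⟨ψ, hψ⟩ := h.exists_potential c'
    refine ⟨Sum.elim (fun σ => ψ σ) fun p => c' p.2.choose * ψ (source 𝓔 p.2.choose), fun C => ?_⟩
    have hs := (Set.mem_image_of_mem orientations C.2).choose_spec
    have hc : c C = c' C := by simp only [c', C.2, dif_pos, Subtype.coe_eta]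
    rw [Sum.elim_inl, Sum.elim_inr, hc]
    rcases orientations_eq hs.2 with h1 | h1
    · simp only [h1]
    · simp only [h1]
      exact hψ _ C.2

end TreeSets

end KGeodetic

namespace KGeodetic

universe u

open scoped Pointwise

section TreeSetActions

variable {V : Type u} {G : Type u} [Group G] [MulAction G V] {𝓔 : Set (Set V)}

theorem smul_source (hinv : ∀ (g : G), ∀ C ∈ 𝓔, g • C ∈ 𝓔) (g : G) (C : Set V) :
    source 𝓔 (g • C) = g • source 𝓔 C := by
  ext D
  rw [Set.mem_smul_set_iff_inv_smul_mem]
  have h1 : D ∈ 𝓔 ↔ g⁻¹ • D ∈ 𝓔 :=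
    ⟨hinv _ D, fun h => by simpa using hinv g _ h⟩
  have h2 : ∀ F : Set V, g • F ⊆ D ↔ F ⊆ g⁻¹ • D := fun F => Set.smul_set_subset_iff_subset_inv_smul_set
  have h3 : D = g • Cᶜ ↔ g⁻¹ • D = Cᶜ := by rw [inv_smul_eq_iff]
  show (D ∈ 𝓔 ∧ (g • C ⊆ D ∨ ((g • C)ᶜ ⊆ D ∧ D ≠ (g • C)ᶜ))) ↔
    (g⁻¹ • D ∈ 𝓔 ∧ (C ⊆ g⁻¹ • D ∨ (Cᶜ ⊆ g⁻¹ • D ∧ g⁻¹ • D ≠ Cᶜ)))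
  rw [← Set.smul_set_compl, h1, h2, h2, Ne, h3]

theorem smul_orientations (g : G) (C : Set V) : orientations (g • C) = g • orientations C := by
  rw [orientations, orientations, ← Set.smul_set_compl]
  exact (Set.image_pair _ _ _).symm

theorem card_stabilizer_smul {α : Type*} [MulAction G α] (g : G) (a : α) :
    Nat.card (MulAction.stabilizer G (g • a)) = Nat.card (MulAction.stabilizer G a) :=
  Nat.card_congr (MulAction.stabilizerEquivStabilizer rfl).toEquiv.symm

/-- The restriction of an action to an invariant set. -/
abbrev invariantAction {α : Type*} [MulAction G α] (s : Set α)
    (hs : ∀ (g : G), ∀ a ∈ s, g • a ∈ s) : MulAction G s where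
  smul g a := ⟨g • (a : α), hs g a a.2⟩
  one_smul a := Subtype.ext (one_smul G (a : α))
  mul_smul g h a := Subtype.ext (mul_smul g h (a : α))

/-- A group acting on a tree set with finitely many orbits and with finite stabilisers of edges and
vertices is virtually free. -/
theorem IsTreeSet.exists_isFreeGroup (h : IsTreeSet 𝓔) (hne : 𝓔.Nonempty)
    (hinv : ∀ (g : G), ∀ C ∈ 𝓔, g • C ∈ 𝓔)
    (hsource : ∀ C ∈ 𝓔, Finite (MulAction.stabilizer G (source 𝓔 C)))
    (horient : ∀ C ∈ 𝓔, Finite (MulAction.stabilizer G (orientations C)))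
    {T : Set (Set V)} (hT : T.Finite) (hTE : T ⊆ 𝓔) (hcov : ∀ C ∈ 𝓔, ∃ g : G, g • C ∈ T) :
    ∃ H : Subgroup G, H.FiniteIndex ∧ IsFreeGroup H := by
  let i₁ : MulAction G 𝓔 := invariantAction 𝓔 hinv
  let i₂ : MulAction G (source 𝓔 '' 𝓔 : Set _) := invariantAction _ (by
    rintro g - ⟨C, hC, rfl⟩
    exact ⟨g • C, hinv g C hC, smul_source hinv g C⟩)
  let i₃ : MulAction G (orientations '' 𝓔 : Set _) := invariantAction _ (by
    rintro g - ⟨C, hC, rfl⟩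
    exact ⟨g • C, hinv g C hC, smul_orientations g C⟩)
  have : Nonempty ((source 𝓔 '' 𝓔 : Set _) ⊕ (orientations '' 𝓔 : Set _)) :=
    ⟨Sum.inl ⟨_, Set.mem_image_of_mem _ hne.some_mem⟩⟩
  have hs₁ : ∀ v : (source 𝓔 '' 𝓔 : Set _), MulAction.stabilizer G
      (Sum.inl v : (source 𝓔 '' 𝓔 : Set _) ⊕ (orientations '' 𝓔 : Set _)) =
      MulAction.stabilizer G (v : Set (Set V)) := by
    intro v
    ext g
    rw [MulAction.mem_stabilizer_iff, MulAction.mem_stabilizer_iff, Sum.smul_inl,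
      Sum.inl_injective.eq_iff, Subtype.ext_iff]
    rfl
  have hs₂ : ∀ v : (orientations '' 𝓔 : Set _), MulAction.stabilizer G
      (Sum.inr v : (source 𝓔 '' 𝓔 : Set _) ⊕ (orientations '' 𝓔 : Set _)) =
      MulAction.stabilizer G (v : Set (Set V)) := by
    intro v
    ext g
    rw [MulAction.mem_stabilizer_iff, MulAction.mem_stabilizer_iff, Sum.smul_inr,
      Sum.inr_injective.eq_iff, Subtype.ext_iff]
    rfl
  refine h.isTreeLike.exists_isFreeGroup (G := G)
    (N := ∏ C ∈ hT.toFinset, Nat.card (MulAction.stabilizer G (source 𝓔 C)) *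
      Nat.card (MulAction.stabilizer G (orientations C)))
    (fun g C => congrArg Sum.inl (Subtype.ext (smul_source hinv g C)))
    (fun g C => congrArg Sum.inr (Subtype.ext (smul_orientations g (C : Set V)))) ?_ ?_ ?_
  · rintro (⟨-, C, hC, rfl⟩ | ⟨-, C, hC, rfl⟩)
    · rw [hs₁]
      exact hsource C hC
    · rw [hs₂]
      exact horient C hC
  · refine Finset.prod_pos fun C hC => ?_
    have hC' := hTE (hT.mem_toFinset.1 hC)
    have := hsource C hC'
    have := horient C hC'
    exact Nat.mul_pos Nat.card_pos Nat.card_pos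
  · rintro (⟨-, C, hC, rfl⟩ | ⟨-, C, hC, rfl⟩)
    · obtain ⟨g, hg⟩ := hcov C hC
      rw [hs₁, ← card_stabilizer_smul g, ← smul_source hinv]
      exact (Dvd.intro _ rfl).trans (Finset.dvd_prod_of_mem _ (hT.mem_toFinset.2 hg))
    · obtain ⟨g, hg⟩ := hcov C hC
      rw [hs₂, ← card_stabilizer_smul g, ← smul_orientations]
      exact (Dvd.intro_left _ rfl).trans (Finset.dvd_prod_of_mem _ (hT.mem_toFinset.2 hg))

end TreeSetActions

end KGeodetic

namespace KGeodetic

open SimpleGraph Filter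

open scoped Pointwise

universe u

section Groups

variable {G : Type u} [Group G] {X : SimpleGraph G}

theorem exists_ultrafilter_of_infinite {α : Type*} {A : Set α} (hA : A.Infinite) :
    ∃ ω : Ultrafilter α, (ω : Filter α) ≤ cofinite ∧ A ∈ ω := by
  have := hA.cofinite_inf_principal_neBot
  refine ⟨Ultrafilter.of (cofinite ⊓ 𝓟 A), (Ultrafilter.of_le _).trans inf_le_left, ?_⟩
  exact Ultrafilter.of_le _ (mem_inf_of_right (mem_principal_self A))

theorem infinite_of_mem_ultrafilter {α : Type*} {A : Set α} {ω : Ultrafilter α}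
    (hω : (ω : Filter α) ≤ cofinite) (hA : A ∈ ω) : A.Infinite := fun hf =>
  Ultrafilter.compl_mem_iff_notMem.1 (hω hf.compl_mem_cofinite) hA

theorem IsLeftInvariant.exists_mem_optCuts_splitting (h : IsLeftInvariant X) {k : ℕ}
    (hk : IsKGeodetic X k) (hX : IsHyperbolic X) {H : Subgroup G} (hH : (H : Set G).Infinite) :
    ∃ E ∈ optCuts X, ((H : Set G) ∩ E).Infinite ∧ ((H : Set G) ∩ Eᶜ).Infinite := by
  obtain ⟨D, hD, h1, h2⟩ := h.exists_splitting hk hX H hH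
  obtain ⟨ω, hω, hω1⟩ := exists_ultrafilter_of_infinite h1
  obtain ⟨ω', hω', hω1'⟩ := exists_ultrafilter_of_infinite h2
  have hsep : Separates D ω ω' := by
    have h3 : D ∈ ω := mem_of_superset hω1 Set.inter_subset_right
    have h4 : Dᶜ ∈ ω' := mem_of_superset hω1' Set.inter_subset_right
    rw [Ultrafilter.compl_mem_iff_notMem] at h4
    exact fun h5 => h4 (h5.1 h3)
  obtain ⟨E, hE⟩ := exists_isOptCut hD hsep
  have hHω : (H : Set G) ∈ ω := mem_of_superset hω1 Set.inter_subset_left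
  have hHω' : (H : Set G) ∈ ω' := mem_of_superset hω1' Set.inter_subset_left
  refine ⟨E, ⟨ω, ω', hω, hω', hE⟩, ?_⟩
  have hs := hE.2.1
  unfold Separates at hs
  by_cases hEω : E ∈ ω
  · have hEω' : Eᶜ ∈ ω' := by
      rw [Ultrafilter.compl_mem_iff_notMem]
      tauto
    exact ⟨infinite_of_mem_ultrafilter hω (inter_mem hHω hEω),
      infinite_of_mem_ultrafilter hω' (inter_mem hHω' hEω')⟩
  · have hEω' : E ∈ ω' := by tauto
    exact ⟨infinite_of_mem_ultrafilter hω' (inter_mem hHω' hEω'),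
      infinite_of_mem_ultrafilter hω
        (inter_mem hHω (Ultrafilter.compl_mem_iff_notMem.2 hEω))⟩

theorem edgeBoundary_nonempty_of_mem_optCuts {V : Type*} {Y : SimpleGraph V} (hY : Y.Connected)
    {C : Set V} (hC : C ∈ optCuts Y) : (edgeBoundary Y C).Nonempty := by
  obtain ⟨u, hu⟩ := nonempty_of_mem_optCuts hC
  obtain ⟨v, hv⟩ := nonempty_of_mem_optCuts (compl_mem_optCuts hC)
  exact edgeBoundary_nonempty hY hu hv

theorem IsLeftInvariant.finite_setOf_smul_eq (h : IsLeftInvariant X) {C D : Set G}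
    (hC : C ∈ optCuts X) (hD : D ∈ optCuts X) : {g : G | g • C = D}.Finite := by
  obtain ⟨⟨u, v⟩, huv⟩ := edgeBoundary_nonempty_of_mem_optCuts h.connected hC
  have hfin := finite_edgeBoundary_of_mem_minCuts (optCuts_subset_minCuts hD)
  refine ((hfin.image Prod.fst).preimage (f := fun g : G => g * u)
    (mul_left_injective u).injOn).subset ?_
  rintro g rfl
  rw [h.edgeBoundary_smul]
  exact ⟨(g * u, g * v), Set.mem_image_of_mem _ huv, rfl⟩

theorem IsLeftInvariant.finite_stabilizer_orientations (h : IsLeftInvariant X) {C : Set G}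
    (hC : C ∈ optCuts X) : Finite (MulAction.stabilizer G (orientations C)) := by
  refine Set.Finite.subset ((h.finite_setOf_smul_eq hC hC).union
    (h.finite_setOf_smul_eq hC (compl_mem_optCuts hC))) fun g hg => ?_
  have hg' : orientations (g • C) = orientations C := by
    rw [smul_orientations]
    exact hg
  exact orientations_eq hg'

theorem IsLeftInvariant.isTreeSet_optCuts (h : IsLeftInvariant X) {k : ℕ}
    (hk : IsKGeodetic X k) (hX : IsHyperbolic X) : IsTreeSet (optCuts X) := by
  obtain ⟨K, hK⟩ := h.exists_ncard_edgeBoundary_minCuts_le hk hX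
  exact ⟨compl_mem_optCuts, nonempty_of_mem_optCuts, nested_of_mem_optCuts h.connected hK,
    finite_optCuts h.connected hK⟩

theorem IsLeftInvariant.finite_stabilizer_source (h : IsLeftInvariant X) {k : ℕ}
    (hk : IsKGeodetic X k) (hX : IsHyperbolic X) {C : Set G} (hC : C ∈ optCuts X) :
    Finite (MulAction.stabilizer G (source (optCuts X) C)) := by
  have hT := h.isTreeSet_optCuts hk hX
  have key : ∀ F ∈ source (optCuts X) C,
      ((MulAction.stabilizer G (source (optCuts X) C) : Set G) ∩ Fᶜ).Finite := by
    intro F hF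
    refine ((hT.finite_source 1 hC).biUnion fun D hD =>
      (h.finite_setOf_smul_eq hF.1 hD.1.1).inv).subset ?_
    rintro g ⟨hg, hgF⟩
    refine Set.mem_biUnion (x := g⁻¹ • F) ⟨?_, ?_⟩ rfl
    · rw [← Set.mem_smul_set_iff_inv_smul_mem, MulAction.mem_stabilizer_iff.1 hg]
      exact hF
    · rw [Set.mem_inv_smul_set_iff, smul_eq_mul, mul_one]
      exact hgF
  by_contra hinf
  obtain ⟨E, hE, h1, h2⟩ := h.exists_mem_optCuts_splitting hk hX
    (H := MulAction.stabilizer G (source (optCuts X) C)) hinf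
  by_cases hE' : E ∈ source (optCuts X) C
  · exact h2 (key E hE')
  · refine h1 ?_
    have := key Eᶜ ((hT.compl_mem_source hC hE).2 hE')
    rwa [compl_compl] at this

/-- A group with a hyperbolic, `k`-geodetic, left-invariant graph structure is virtually free. -/
theorem IsLeftInvariant.exists_isFreeGroup (h : IsLeftInvariant X) {k : ℕ}
    (hk : IsKGeodetic X k) (hX : IsHyperbolic X) :
    ∃ H : Subgroup G, H.FiniteIndex ∧ IsFreeGroup H := by
  rcases finite_or_infinite G with hG | hG
  · exact ⟨⊥, inferInstance, IsFreeGroup.ofMulEquiv (MulEquiv.ofUnique (M := FreeGroup PEmpty.{1}))⟩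
  have hT := h.isTreeSet_optCuts hk hX
  obtain ⟨E, hE, -, -⟩ := h.exists_mem_optCuts_splitting hk hX (H := ⊤) Set.infinite_univ
  refine hT.exists_isFreeGroup (G := G) ⟨E, hE⟩ (fun g C hC => h.smul_mem_optCuts g hC)
    (fun C hC => h.finite_stabilizer_source hk hX hC)
    (fun C hC => h.finite_stabilizer_orientations hC)
    ((h.finite_adj 1).biUnion fun v _ => hT.finite 1 v)
    (Set.iUnion₂_subset fun v _ C hC => hC.1) fun C hC => ?_
  obtain ⟨⟨u, v⟩, huv, hu, hv⟩ := edgeBoundary_nonempty_of_mem_optCuts h.connected hC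
  refine ⟨u⁻¹, Set.mem_biUnion (x := u⁻¹ * v) ?_ ⟨h.smul_mem_optCuts _ hC, ?_, ?_⟩⟩
  · have := (h.adj_mul u⁻¹ u v).2 huv
    rwa [inv_mul_cancel] at this
  · rw [Set.mem_inv_smul_set_iff, smul_eq_mul, mul_one]
    exact hu
  · rw [Set.mem_inv_smul_set_iff, smul_eq_mul, mul_inv_cancel_left]
    exact hv

theorem isLeftInvariant_cayleyGraph {S : Set G} (hS : S.Finite) {k : ℕ}
    (hk : IsKGeodetic (cayleyGraph G S) k) : IsLeftInvariant (cayleyGraph G S) where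
  connected := hk.1
  adj_mul c x y := by
    have key : ∀ x y, (c * x)⁻¹ * (c * y) = x⁻¹ * y := fun x y => by group
    simp only [cayleyGraph, fromRel_adj, key, ne_eq, mul_right_inj]
  finite_adj x := by
    refine ((hS.image (x * ·)).union (hS.inv.image (x * ·))).subset ?_
    rintro y ⟨-, hy | hy⟩
    · exact Or.inl ⟨_, hy, mul_inv_cancel_left x y⟩
    · refine Or.inr ⟨_, Set.inv_mem_inv.2 hy, ?_⟩
      show x * (y⁻¹ * x)⁻¹ = y
      group

end Groups

end KGeodetic

/-- **Theorem B.** If `G` is a hyperbolic group admitting a finite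
inverse-closed generating set `S` such that `Cay(G, S)` is `k`-geodetic, then `G` is
virtually free (has a free subgroup of finite index), and the centraliser of every
element of infinite order in `G` is an infinite cyclic group. -/
theorem hyperbolic_kgeodetic_virtually_free_and_centralizers {G : Type*} [Group G]
    (k : ℕ) (hk : 0 < k) (S : Set G) (hfin : S.Finite) (hinv : ∀ s ∈ S, s⁻¹ ∈ S)
    (hone : (1 : G) ∉ S) (hgen : Subgroup.closure S = ⊤)
    (hhyp : IsHyperbolic (cayleyGraph G S))
    (hgeo : IsKGeodetic (cayleyGraph G S) k) :
    (∃ H : Subgroup G, H.FiniteIndex ∧ IsFreeGroup H) ∧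
    ∀ g : G, ¬ IsOfFinOrder g →
      Nonempty ((Subgroup.centralizer {g}) ≃* Multiplicative ℤ) := by
  have h := KGeodetic.isLeftInvariant_cayleyGraph hfin hgeo
  exact ⟨h.exists_isFreeGroup hgeo hhyp, fun g hg => h.nonempty_centralizer_mulEquiv hgeo hhyp hg⟩
end

section
/- Let k be a positive integer and let G be a hyperbolic group with a finite inverse-closed generating set S such that Cay(G,S) is k-geodetic. If g, h ∈ G are commuting non-trivial elements and g has finite order, then both gh and h have finite order. -/
namespace SimpleGraph

variable {V : Type*} {X : SimpleGraph V}

lemma Connected.dist_getVert_add_le (hX : X.Connected) {u v : V} (p : X.Walk u v) (i d : ℕ) :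
    X.dist (p.getVert i) (p.getVert (i + d)) ≤ d := by
  induction d with
  | zero => simp
  | succ d ih =>
    have h1 : X.dist (p.getVert (i + d)) (p.getVert (i + d + 1)) ≤ 1 := by
      rcases lt_or_ge (i + d) p.length with h | h
      · exact (dist_eq_one_iff_adj.2 (p.adj_getVert_succ h)).le
      · rw [p.getVert_of_length_le h, p.getVert_of_length_le (by omega)]
        simp
    have h2 := hX.dist_triangle (u := p.getVert i) (v := p.getVert (i + d))
      (w := p.getVert (i + d + 1))
    rw [← add_assoc]
    omega

lemma Connected.dist_getVert_add (hX : X.Connected) {u v : V} (p : X.Walk u v)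
    (hp : p.length = X.dist u v) {i d : ℕ} (h : i + d ≤ p.length) :
    X.dist (p.getVert i) (p.getVert (i + d)) = d := by
  have h1 := hX.dist_getVert_add_le p 0 i
  have h2 := hX.dist_getVert_add_le p i d
  have h3 := hX.dist_getVert_add_le p (i + d) (p.length - (i + d))
  rw [Nat.add_sub_cancel' h, p.getVert_length] at h3
  rw [p.getVert_zero, zero_add] at h1
  have h4 := hX.dist_triangle (u := u) (v := p.getVert i) (w := v)
  have h5 := hX.dist_triangle (u := p.getVert i) (v := p.getVert (i + d)) (w := v)
  omega

/-- A vertex sequence is a geodesic ray if it realises the distance between any two of its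
terms. -/
def IsGeodesicRay (X : SimpleGraph V) (α : ℕ → V) : Prop :=
  ∀ i d : ℕ, X.dist (α i) (α (i + d)) = d

lemma IsGeodesicRay.dist_of_le {α : ℕ → V} (hα : X.IsGeodesicRay α) {i j : ℕ} (h : i ≤ j) :
    X.dist (α i) (α j) = j - i := by
  obtain ⟨d, rfl⟩ := Nat.exists_eq_add_of_le h
  rw [hα, Nat.add_sub_cancel_left]

/-- If a sequence of geodesics of unbounded length issues from a common vertex of a graph with
finite balls, then some geodesic ray has each of its finite initial parts on geodesics of the
sequence. -/
lemma exists_isGeodesicRay (hX : X.Connected) (u : V)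
    (hball : ∀ r : ℕ, {v | X.dist u v ≤ r}.Finite) (v : ℕ → V) (hv : Function.Injective v)
    (p : ∀ m, X.Walk u (v m)) (hp : ∀ m, (p m).length = X.dist u (v m)) :
    ∃ α : ℕ → V, X.IsGeodesicRay α ∧
      ∀ i, ∃ m, i ≤ (p m).length ∧ (p m).getVert i = α i := by
  have hex (i : ℕ) : ∃ a, ∀ᶠ m in Filter.hyperfilter ℕ, (p m).getVert i = a := by
    have h1 : ∀ᶠ m in Filter.hyperfilter ℕ, ∃ a ∈ {a | X.dist u a ≤ i}, (p m).getVert i = a := by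
      refine Filter.Eventually.of_forall fun m ↦ ⟨_, ?_, rfl⟩
      simpa using hX.dist_getVert_add_le (p m) 0 i
    obtain ⟨a, -, ha⟩ := (Ultrafilter.eventually_exists_mem_iff (hball i)).1 h1
    exact ⟨a, ha⟩
  have hlen (i : ℕ) : ∀ᶠ m in Filter.hyperfilter ℕ, i ≤ (p m).length := by
    apply Filter.mem_hyperfilter_of_finite_compl
    refine ((hball i).preimage hv.injOn).subset fun m hm ↦ ?_
    have hm : ¬ i ≤ (p m).length := hm
    change X.dist u (v m) ≤ i
    rw [← hp]
    omega
  choose α hα using hex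
  refine ⟨α, fun i d ↦ ?_, fun i ↦ ((hlen i).and (hα i)).exists⟩
  obtain ⟨m, ⟨h1, h2⟩, h3⟩ := (((hα i).and (hα (i + d))).and (hlen (i + d))).exists
  rw [← h1, ← h2]
  exact hX.dist_getVert_add (p m) (hp m) h3

/-- The distances between far away points of two asymptotic geodesic rays are eventually those of
the points of one ray, up to a shift. -/
lemma IsGeodesicRay.exists_dist_eq (hX : X.Connected) {α β : ℕ → V} (hα : X.IsGeodesicRay α)
    (hβ : X.IsGeodesicRay β) {C : ℕ} (hC : ∀ i, X.dist (α i) (β i) ≤ C) :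
    ∃ (c : ℤ) (I : ℕ), ∀ i, I ≤ i → ∃ M, ∀ N, M ≤ N → (X.dist (α i) (β N) : ℤ) = N + c - i := by
  let f (i N : ℕ) : ℤ := X.dist (α i) (β N) + i - N
  have hstep (i N : ℕ) : f i N ≤ f (i + 1) N := by
    have h1 := hX.dist_triangle (u := α i) (v := α (i + 1)) (w := β N)
    have h2 := hα i 1
    simp only [f]
    omega
  have hanti (i N d : ℕ) : f i (N + d) ≤ f i N := by
    have h1 := hX.dist_triangle (u := α i) (v := β N) (w := β (N + d))
    have h2 := hβ N d
    simp only [f]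
    omega
  have hmono {i j : ℕ} (h : i ≤ j) (N : ℕ) : f i N ≤ f j N :=
    monotone_nat_of_le_succ (f := fun i ↦ f i N) (fun i ↦ hstep i N) h
  obtain ⟨c, ⟨I, hI⟩, hc⟩ := Int.exists_greatest_of_bdd (P := fun c ↦ ∃ i, ∀ N, c ≤ f i N)
    ⟨C, fun z ⟨i, hi⟩ ↦ by
      have h1 := hi i
      have h2 := hC i
      simp only [f] at h1
      omega⟩
    ⟨-C, 0, fun N ↦ by
      have h1 := hX.dist_triangle (u := α 0) (v := β N) (w := α N)
      have h2 := hα.dist_of_le (Nat.zero_le N)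
      have h3 := hC N
      rw [dist_comm] at h3
      simp only [f]
      omega⟩
  refine ⟨c, I, fun i hi ↦ ?_⟩
  obtain ⟨M, hM⟩ : ∃ M, f i M ≤ c := by
    by_contra! h
    have := hc (c + 1) ⟨i, h⟩
    omega
  refine ⟨M, fun N hN ↦ ?_⟩
  obtain ⟨d, rfl⟩ := Nat.exists_eq_add_of_le hN
  have h1 := hanti i M d
  have h2 := (hI (M + d)).trans (hmono hi (M + d))
  simp only [f] at h1 h2 hM
  omega

/-- Two geodesic rays that keep differing, although distances between them are eventually those
of points on one ray, are joined by arbitrarily many geodesics. -/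
lemma IsGeodesicRay.exists_many_geodesics (hX : X.Connected) {α β : ℕ → V}
    (hα : X.IsGeodesicRay α) (hβ : X.IsGeodesicRay β) {c : ℤ} {I : ℕ}
    (hdist : ∀ i, I ≤ i → ∃ M, ∀ N, M ≤ N → (X.dist (α i) (β N) : ℤ) = N + c - i)
    (hne : ∀ m, ∃ t N : ℕ, m ≤ t ∧ m ≤ N ∧ (t : ℤ) = N + c ∧ α t ≠ β N) (n : ℕ) :
    ∀ i, I ≤ i → ∃ E, ∀ N, E ≤ N → ∃ s : Finset (X.Walk (α i) (β N)), s.card = n ∧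
      ∀ p ∈ s, p.length = X.dist (α i) (β N) := by
  classical
  induction n with
  | zero => exact fun i _ ↦ ⟨0, fun N _ ↦ ⟨∅, by simp⟩⟩
  | succ n ih =>
    intro i hi
    obtain ⟨M, hM⟩ := hdist i hi
    obtain ⟨t, T, htm, hTm, htT, htne⟩ := hne (max M i)
    have hit : i ≤ t := (le_max_right _ _).trans htm
    have hMT : M ≤ T := (le_max_left _ _).trans hTm
    obtain ⟨M', hM'⟩ := hdist t (hi.trans hit)
    obtain ⟨E, hE⟩ := ih t (hi.trans hit)
    refine ⟨max (max E T) M', fun N hN ↦ ?_⟩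
    have hEN : E ≤ N := by omega
    have hTN : T ≤ N := by omega
    have hN1 := hM N (hMT.trans hTN)
    have hN2 := hM' N (by omega)
    have hT1 := hM T hMT
    obtain ⟨s, hs, hsl⟩ := hE N hEN
    obtain ⟨q, hq⟩ := hX.exists_walk_length_eq_dist (α i) (α t)
    obtain ⟨r, hr⟩ := hX.exists_walk_length_eq_dist (α i) (β T)
    obtain ⟨r', hr'⟩ := hX.exists_walk_length_eq_dist (β T) (β N)
    rw [hα.dist_of_le hit] at hq
    rw [hβ.dist_of_le hTN] at hr'
    have hinj : Function.Injective (fun w : X.Walk (α t) (β N) ↦ q.append w) := by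
      intro w w' h
      have h := congrArg Walk.support h
      simp only [Walk.support_append] at h
      apply Walk.ext_support
      rw [← w.cons_tail_support, ← w'.cons_tail_support, List.append_cancel_left h]
    refine ⟨insert (r.append r') (s.image fun w ↦ q.append w), ?_, ?_⟩
    · rw [Finset.card_insert_of_notMem, Finset.card_image_of_injective _ hinj, hs]
      intro hmem
      obtain ⟨w, -, hw⟩ := Finset.mem_image.1 hmem
      have h := congrArg (fun p ↦ Walk.getVert p (t - i)) hw
      have hrl : r.length = t - i := by omega
      simp [Walk.getVert_append, hq, hrl] at h
      exact htne h
    · intro p hp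
      rcases Finset.mem_insert.1 hp with rfl | hp
      · rw [Walk.length_append]
        omega
      · obtain ⟨w, hw, rfl⟩ := Finset.mem_image.1 hp
        have := hsl w hw
        rw [Walk.length_append]
        omega

end SimpleGraph

/-- Asymptotic geodesic rays in a `k`-geodetic graph eventually coincide up to a shift. -/
lemma IsKGeodetic.exists_shift_eq {V : Type*} {X : SimpleGraph V} {k : ℕ} (hX : IsKGeodetic X k)
    {α β : ℕ → V} (hα : X.IsGeodesicRay α) (hβ : X.IsGeodesicRay β) {C : ℕ}
    (hC : ∀ i, X.dist (α i) (β i) ≤ C) :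
    ∃ (c : ℤ) (m : ℕ), ∀ t N : ℕ, m ≤ t → m ≤ N → (t : ℤ) = N + c → α t = β N := by
  obtain ⟨c, I, hI⟩ := hα.exists_dist_eq hX.1 hβ hC
  refine ⟨c, ?_⟩
  by_contra! hne
  obtain ⟨E, hE⟩ := hα.exists_many_geodesics hX.1 hβ hI hne (k + 1) I le_rfl
  obtain ⟨s, hs, hsl⟩ := hE E le_rfl
  have := hX.2 _ _ s hsl
  omega

section CayleyGraph

variable {G : Type*} [Group G] {S : Set G}

/-- Left multiplication as an endomorphism of the Cayley graph. -/
def cayleyGraphMulLeft (S : Set G) (g : G) : cayleyGraph G S →g cayleyGraph G S where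
  toFun := (g * ·)
  map_rel' := by
    intro a b h
    simpa [cayleyGraph, SimpleGraph.fromRel_adj, mul_assoc] using h

lemma cayleyGraph_dist_mul_left (hX : (cayleyGraph G S).Connected) (g a b : G) :
    (cayleyGraph G S).dist (g * a) (g * b) = (cayleyGraph G S).dist a b := by
  have hle (g a b : G) : (cayleyGraph G S).dist (g * a) (g * b) ≤ (cayleyGraph G S).dist a b := by
    obtain ⟨p, hp⟩ := hX.exists_walk_length_eq_dist a b
    rw [← hp, ← p.length_map (cayleyGraphMulLeft S g)]
    exact SimpleGraph.dist_le _
  refine (hle g a b).antisymm ?_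
  simpa using hle g⁻¹ (g * a) (g * b)

lemma cayleyGraph_finite_ball (hX : (cayleyGraph G S).Connected) (hfin : S.Finite)
    (hinv : ∀ s ∈ S, s⁻¹ ∈ S) (a : G) (r : ℕ) :
    {b | (cayleyGraph G S).dist a b ≤ r}.Finite := by
  induction r with
  | zero =>
    refine (Set.finite_singleton a).subset fun b hb ↦ ?_
    exact (hX.dist_eq_zero_iff.1 (Nat.le_zero.1 hb)).symm
  | succ r ih =>
    refine (ih.union (Set.Finite.image2 (· * ·) ih hfin)).subset fun b hb ↦ ?_
    obtain ⟨p, hp⟩ := hX.exists_walk_length_eq_dist a b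
    have hb : (cayleyGraph G S).dist a b ≤ r + 1 := hb
    rcases hb.lt_or_eq with hlt | heq
    · exact Or.inl (Nat.lt_succ_iff.1 hlt)
    · right
      have hadj := p.adj_getVert_succ (i := r) (by omega)
      rw [p.getVert_of_length_le (i := r + 1) (by omega)] at hadj
      refine ⟨p.getVert r, ?_, (p.getVert r)⁻¹ * b, ?_, by simp⟩
      · simpa using hX.dist_getVert_add_le p 0 r
      · have hadj := (SimpleGraph.fromRel_adj _ _ _).1 hadj
        rcases hadj.2 with h | h
        · exact h
        · simpa using hinv _ h

/-- In a hyperbolic Cayley graph, if `g` commutes with an element `h` of infinite order, then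
some geodesic ray stays within bounded distance of its translate by `g`. -/
lemma IsHyperbolic.exists_ray_dist_mul_le (hhyp : IsHyperbolic (cayleyGraph G S))
    (hX : (cayleyGraph G S).Connected) (hfin : S.Finite) (hinv : ∀ s ∈ S, s⁻¹ ∈ S)
    {g h : G} (hcomm : Commute g h) (hh : ¬ IsOfFinOrder h) :
    ∃ α : ℕ → G, (cayleyGraph G S).IsGeodesicRay α ∧
      ∃ C : ℕ, ∀ i, (cayleyGraph G S).dist (α i) (g * α i) ≤ C := by
  set X := cayleyGraph G S
  have hmul (a b c : G) : X.dist (a * b) (a * c) = X.dist b c :=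
    cayleyGraph_dist_mul_left hX a b c
  choose p hp using fun m : ℕ ↦ hX.exists_walk_length_eq_dist 1 (h ^ m)
  obtain ⟨α, hα, hpα⟩ := SimpleGraph.exists_isGeodesicRay hX 1
    (cayleyGraph_finite_ball hX hfin hinv 1) (fun m ↦ h ^ m)
    (injective_pow_iff_not_isOfFinOrder.2 hh) p hp
  obtain ⟨δ, -, hδ⟩ := hhyp
  refine ⟨α, hα, ⌈X.dist 1 g + 2 * δ⌉₊, fun i ↦ ?_⟩
  obtain ⟨m, him, hi⟩ := hpα i
  have hx : X.dist (α i) 1 = i := by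
    have := hX.dist_getVert_add (p m) (hp m) (i := 0) (d := i) (by omega)
    rw [SimpleGraph.dist_comm]
    simpa [hi] using this
  have hy : X.dist (α i) (h ^ m) = (p m).length - i := by
    have := hX.dist_getVert_add (p m) (hp m) (i := i) (d := (p m).length - i) (by omega)
    rwa [Nat.add_sub_cancel' him, (p m).getVert_length, hi] at this
  have h1 : X.dist (g * α i) (h ^ m) ≤ (p m).length - i + X.dist 1 g := by
    have ht := hX.dist_triangle (u := g * α i) (v := g * h ^ m) (w := h ^ m)
    have hm : X.dist (g * h ^ m) (h ^ m) = X.dist 1 g := by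
      rw [(hcomm.pow_right m).eq, SimpleGraph.dist_comm]
      simpa using hmul (h ^ m) 1 g
    rw [hmul] at ht
    omega
  have h2 : X.dist (g * α i) 1 ≤ i + X.dist 1 g := by
    have ht := hX.dist_triangle (u := g * α i) (v := g) (w := 1)
    have hm : X.dist (g * α i) g = i := by
      simpa [hx] using hmul g (α i) 1
    rw [SimpleGraph.dist_comm (u := g)] at ht
    omega
  have h4 := hδ (α i) (g * α i) 1 (h ^ m)
  have hmax : max ((X.dist (α i) 1 : ℝ) + X.dist (g * α i) (h ^ m))
      (X.dist (α i) (h ^ m) + X.dist (g * α i) 1) ≤ X.dist 1 (h ^ m) + X.dist 1 g := by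
    rw [← hp]
    apply max_le <;> norm_cast <;> omega
  have h5 : (X.dist (α i) (g * α i) : ℝ) ≤ X.dist 1 g + 2 * δ := by linarith
  exact_mod_cast h5.trans (Nat.le_ceil _)

/-- An element of finite order that translates a geodesic ray to one eventually equal to it up to
a shift is trivial. -/
lemma SimpleGraph.IsGeodesicRay.eq_one_of_shift {X : SimpleGraph G} {α : ℕ → G}
    (hα : X.IsGeodesicRay α) {g : G} (hg : IsOfFinOrder g) {c : ℤ} {m : ℕ}
    (h : ∀ t N : ℕ, m ≤ t → m ≤ N → (t : ℤ) = N + c → α t = g * α N) : g = 1 := by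
  have hiter (j : ℕ) : ∀ t N : ℕ, m + j * c.natAbs ≤ N → (t : ℤ) = N + j * c →
      α t = g ^ j * α N := by
    induction j with
    | zero =>
      intro t N _ ht
      obtain rfl : t = N := by simpa using ht
      simp
    | succ j ih =>
      intro t N hN ht
      have hN' : m + j * c.natAbs + c.natAbs ≤ N := by linarith [add_one_mul j c.natAbs]
      obtain ⟨N', hN'c⟩ : ∃ N' : ℕ, (N' : ℤ) = N + c := ⟨(N + c).toNat, by omega⟩
      have hle : m + j * c.natAbs ≤ N' := by omega
      rw [ih t N' hle (by rw [ht, hN'c]; push_cast; ring), h N' N (by omega) (by omega) hN'c,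
        pow_succ, mul_assoc]
  obtain ⟨n, hn, hgn⟩ := hg.exists_pow_eq_one
  have hc : c = 0 := by
    have habs : |(n : ℤ) * c| = n * c.natAbs := by simp [abs_mul]
    have hnc := neg_abs_le ((n : ℤ) * c)
    obtain ⟨t, ht⟩ : ∃ t : ℕ, (t : ℤ) = (m + n * c.natAbs : ℕ) + n * c :=
      ⟨((m + n * c.natAbs : ℕ) + n * c : ℤ).toNat, by
        rw [Int.toNat_of_nonneg]; push_cast; push_cast at habs; linarith⟩
    have heq := hiter n t _ le_rfl ht
    rw [hgn, one_mul] at heq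
    have htN : t = m + n * c.natAbs := by
      rcases le_total t (m + n * c.natAbs) with hle | hle
      · have := hα.dist_of_le hle
        rw [heq, SimpleGraph.dist_self] at this
        omega
      · have := hα.dist_of_le hle
        rw [heq, SimpleGraph.dist_self] at this
        omega
    have hz : (n : ℤ) * c = 0 := by
      rw [htN] at ht
      linarith
    rcases mul_eq_zero.1 hz with h0 | h0
    · omega
    · exact h0
  simpa using h m m le_rfl le_rfl (by simp [hc])

end CayleyGraph


/-- Let `G` be a hyperbolic group with a finite inverse-closed
generating set `S` such that `Cay(G, S)` is `k`-geodetic. If `g, h ∈ G` are commuting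
non-trivial elements and `g` has finite order, then both `g * h` and `h` have finite
order. -/
theorem finiteOrder_of_commuting {G : Type*} [Group G]
    (k : ℕ) (hk : 0 < k) (S : Set G) (hfin : S.Finite) (hinv : ∀ s ∈ S, s⁻¹ ∈ S)
    (hone : (1 : G) ∉ S) (hgen : Subgroup.closure S = ⊤)
    (hhyp : IsHyperbolic (cayleyGraph G S))
    (hgeo : IsKGeodetic (cayleyGraph G S) k)
    (g h : G) (hg1 : g ≠ 1) (hh1 : h ≠ 1) (hcomm : g * h = h * g)
    (hord : IsOfFinOrder g) :
    IsOfFinOrder (g * h) ∧ IsOfFinOrder h := by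
  have hh : IsOfFinOrder h := by
    by_contra hh
    have hX := hgeo.1
    obtain ⟨α, hα, C, hC⟩ := hhyp.exists_ray_dist_mul_le hX hfin hinv (g := g) hcomm hh
    have hβ : (cayleyGraph G S).IsGeodesicRay (fun i ↦ g * α i) := fun i d ↦ by
      rw [cayleyGraph_dist_mul_left hX, hα]
    obtain ⟨c, m, hm⟩ := hgeo.exists_shift_eq hα hβ hC
    exact hg1 (hα.eq_one_of_shift hord hm)
  exact ⟨Commute.isOfFinOrder_mul hcomm hord hh, hh⟩
end

section
/- Let k be a positive integer and let G be a hyperbolic group with a finite inverse-closed generating set S such that Cay(G,S) is k-geodetic. If g, h ∈ G are commuting non-trivial elements and g has infinite order, then h has infinite order, and either h = g⁻¹ or gh has infinite order. -/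
open SimpleGraph in
/-- A sequence of consecutively adjacent vertices is traced by a walk. -/
lemma exists_walk_of_adj {V : Type*} {X : SimpleGraph V} (f : ℕ → V) (n : ℕ)
    (hf : ∀ i < n, X.Adj (f i) (f (i + 1))) :
    ∃ p : X.Walk (f 0) (f n), p.length = n ∧ ∀ i ≤ n, p.getVert i = f i := by
  induction n generalizing f with
  | zero => exact ⟨Walk.nil, rfl, fun i hi => by simp [Nat.le_zero.1 hi]⟩
  | succ n ih =>
    obtain ⟨p, hp, hv⟩ := ih (fun i => f (i + 1)) fun i hi => hf (i + 1) (by omega)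
    refine ⟨Walk.cons (hf 0 (by omega)) p, by simp [hp], fun i hi => ?_⟩
    cases i with
    | zero => simp
    | succ i => simpa using hv i (by omega)

lemma IsKGeodetic.exists_lt_eq {V : Type*} {X : SimpleGraph V} {k : ℕ} (hX : IsKGeodetic X k)
    {u v : V} (w : ℕ → X.Walk u v) (hw : ∀ a ≤ k, (w a).length = X.dist u v) :
    ∃ a b, a < b ∧ b ≤ k ∧ w a = w b := by
  classical
  by_contra! hne
  have hinj : Set.InjOn w (Finset.range (k + 1)) := by
    intro a ha b hb hab
    simp only [Finset.coe_range, Set.mem_Iio] at ha hb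
    rcases lt_trichotomy a b with h | h | h
    · exact absurd hab (hne a b h (by omega))
    · exact h
    · exact absurd hab.symm (hne b a h (by omega))
  have hcard := hX.2 u v ((Finset.range (k + 1)).image w) fun p hp => by
    obtain ⟨a, ha, rfl⟩ := Finset.mem_image.1 hp
    exact hw a (by simpa [Nat.lt_succ_iff] using ha)
  rw [Finset.card_image_of_injOn hinj, Finset.card_range] at hcard
  omega

/-- A bounded function of intervals which increases on passing to subintervals takes the same
value on some interval and on all pieces of an equal subdivision of it. -/
lemma exists_const_on_subdivision (e : ℕ → ℕ → ℤ) (R D K L : ℕ)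
    (hmono : ∀ p p' q' q, p ≤ p' → p' ≤ q' → q' ≤ q → q ≤ L → e p q ≤ e p' q')
    (hlow : ∀ p q, p ≤ q → q ≤ L → -(R : ℤ) ≤ e p q)
    (hup : ∀ p q, p ≤ q → q ≤ L → e p q ≤ R)
    (hL : D * K ^ (2 * R + 1) ≤ L) (hK : 0 < K) :
    ∃ b E, D ≤ E ∧ b + K * E ≤ L ∧
      ∀ a < K, e (b + a * E) (b + (a + 1) * E) = e b (b + K * E) := by
  by_contra! hcon
  have key : ∀ s b : ℕ, b + D * K ^ s ≤ L → ¬ ((R : ℤ) + 1 - s ≤ e b (b + D * K ^ s)) := by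
    intro s
    induction s with
    | zero =>
      intro b hb h
      have := hup b (b + D * K ^ 0) (by omega) hb
      push_cast at h
      omega
    | succ s ih =>
      intro b hb h
      have hE : D * K ^ (s + 1) = K * (D * K ^ s) := by ring
      rw [hE] at hb h
      obtain ⟨a, ha, hne⟩ := hcon b (D * K ^ s) (Nat.le_mul_of_pos_right _ (by positivity)) hb
      have h1 : (a + 1) * (D * K ^ s) ≤ K * (D * K ^ s) := Nat.mul_le_mul_right _ ha
      have h2 : (a + 1) * (D * K ^ s) = a * (D * K ^ s) + D * K ^ s := by ring
      have hle := hmono b (b + a * (D * K ^ s)) (b + (a + 1) * (D * K ^ s)) (b + K * (D * K ^ s))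
        (by omega) (by omega) (by omega) hb
      refine ih (b + a * (D * K ^ s)) (by omega) ?_
      rw [add_assoc, ← h2]
      push_cast at h
      have := lt_of_le_of_ne hle (Ne.symm hne)
      omega
  refine key (2 * R + 1) 0 (by omega) ?_
  have := hlow 0 (0 + D * K ^ (2 * R + 1)) (by omega) (by omega)
  push_cast at this ⊢
  omega

lemma iterate_eq_of_shift {V : Type*} {φ : V → V} {γ : ℕ → V} {A B s : ℕ}
    (h : ∀ i, A ≤ i → i + s ≤ B → φ (γ i) = γ (i + s)) (r : ℕ) (hr : A + r * s ≤ B) :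
    φ^[r] (γ A) = γ (A + r * s) := by
  induction r with
  | zero => simp
  | succ r ih =>
    have h1 : (r + 1) * s = r * s + s := by ring
    rw [Function.iterate_succ_apply', ih (by omega), h _ (by omega) (by omega), h1, add_assoc]

lemma iterate_eq_of_shift_back {V : Type*} {φ : V → V} {γ : ℕ → V} {A B s : ℕ}
    (h : ∀ i, A ≤ i → i + s ≤ B → φ (γ (i + s)) = γ i) (r : ℕ) (hr : A + r * s ≤ B) :
    φ^[r] (γ (A + r * s)) = γ A := by
  induction r with
  | zero => simp
  | succ r ih =>
    have h1 : (r + 1) * s = r * s + s := by ring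
    rw [Function.iterate_succ_apply, h1, ← add_assoc, h _ (by omega) (by omega), ih (by omega)]

open SimpleGraph in
/-- Let `γ` be a geodesic. If on an interval and on the pieces of an equal subdivision of it the
distance from `γ p` to `φ (γ q)` exceeds `q - p` by the same amount `e`, then `φ` translates a
long piece of `γ` by `e`, provided that there are more pieces than there can be geodesics. -/
lemma exists_shift_of_const {V : Type*} {X : SimpleGraph V} {k : ℕ} (hX : IsKGeodetic X k)
    {φ : V → V} (hφ : ∀ x y, X.dist (φ x) (φ y) = X.dist x y) {γ : ℕ → V} {L b E : ℕ} {e : ℤ}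
    (hγ : ∀ i j, i ≤ j → j ≤ L → X.dist (γ i) (γ j) = j - i)
    (hb : b + (2 * k + 2) * E ≤ L)
    (hI : (X.dist (γ b) (φ (γ (b + (2 * k + 2) * E))) : ℤ) = (2 * k + 2) * E + e)
    (hJ : ∀ a < 2 * k + 2, (X.dist (γ (b + a * E)) (φ (γ (b + (a + 1) * E))) : ℤ) = E + e) :
    ∃ A, A + E ≤ L ∧ ∀ i j : ℕ, A ≤ i → i ≤ A + E → A ≤ j → j ≤ A + E → (j : ℤ) = i + e →
      φ (γ i) = γ j := by
  have hadj : ∀ i < L, X.Adj (γ i) (γ (i + 1)) := fun i hi =>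
    dist_eq_one_iff_adj.1 (by rw [hγ i (i + 1) (by omega) (by omega)]; omega)
  have hadj' : ∀ i < L, X.Adj (φ (γ i)) (φ (γ (i + 1))) := fun i hi =>
    dist_eq_one_iff_adj.1 (by rw [hφ, hγ i (i + 1) (by omega) (by omega)]; omega)
  set K := 2 * k + 2 with hK
  have hw : ∀ a, ∃ w : X.Walk (γ b) (φ (γ (b + K * E))), a ≤ k →
      w.length = X.dist (γ b) (φ (γ (b + K * E))) ∧
      (∀ m ≤ 2 * a * E, w.getVert m = γ (b + m)) ∧
      ∀ m n : ℕ, (2 * a + 1) * E + m ≤ K * E → (n : ℤ) = (2 * a + 1) * E + e + m →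
        w.getVert n = φ (γ (b + (2 * a + 1) * E + m)) := by
    intro a
    by_cases ha : a ≤ k
    swap
    · exact ⟨(hX.1 _ _).some, fun h => absurd h ha⟩
    have hle : (2 * a + 1) * E ≤ K * E := Nat.mul_le_mul_right _ (by omega)
    have hsucc : (2 * a + 1) * E = 2 * a * E + E := by ring
    obtain ⟨P, hP, hPv⟩ := exists_walk_of_adj (X := X) (fun i => γ (b + i)) (2 * a * E)
      fun i hi => hadj (b + i) (by omega)
    obtain ⟨Q, hQ, hQv⟩ := exists_walk_of_adj (X := X) (fun i => φ (γ (b + (2 * a + 1) * E + i)))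
      (K * E - (2 * a + 1) * E) fun i hi => hadj' (b + (2 * a + 1) * E + i) (by omega)
    obtain ⟨C, hC⟩ := hX.1.exists_walk_length_eq_dist (γ (b + 2 * a * E))
      (φ (γ (b + (2 * a + 1) * E)))
    have hCl : (C.length : ℤ) = E + e := by
      rw [hC]; exact hJ (2 * a) (by omega)
    have hend : b + (2 * a + 1) * E + (K * E - (2 * a + 1) * E) = b + K * E := by omega
    refine ⟨((P.append C).append Q).copy rfl (by rw [hend]), fun _ => ⟨?_, ?_, ?_⟩⟩
    · zify
      rw [hI]
      simp only [Walk.length_copy, Walk.length_append, hP, hQ]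
      push_cast [Nat.cast_sub hle, hCl]
      push_cast [hK]
      ring
    · intro m hm
      rw [Walk.getVert_copy, Walk.getVert_append, Walk.getVert_append]
      rw [Walk.length_append, hP]
      by_cases hlt : m < 2 * a * E
      · rw [if_pos (by omega), if_pos hlt, hPv m hm]
      · obtain rfl : m = 2 * a * E := by omega
        by_cases hC0 : C.length = 0
        · rw [if_neg (by omega), hC0]
          have := hQv 0 (by omega)
          simp only [add_zero, Nat.sub_self] at this ⊢
          rw [this]
          exact (Walk.eq_of_length_eq_zero hC0).symm
        · rw [if_pos (by omega), if_neg hlt]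
          simp
    · intro m n hm hn
      have hn' : n = 2 * a * E + C.length + m := by
        zify
        rw [hn, hCl]
        ring
      rw [Walk.getVert_copy, Walk.getVert_append, Walk.length_append, hP, if_neg (by omega),
        hn', Nat.add_sub_cancel_left, hQv m (by omega)]
  choose w hw using hw
  obtain ⟨a, a', haa, ha', heq⟩ := hX.exists_lt_eq w fun a ha => (hw a ha).1
  have h1 : (2 * a + 1) * E + E ≤ 2 * a' * E := by
    calc (2 * a + 1) * E + E = (2 * a + 2) * E := by ring
      _ ≤ _ := Nat.mul_le_mul_right _ (by omega)
  have h2 : 2 * a' * E ≤ K * E := Nat.mul_le_mul_right _ (by omega)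
  refine ⟨b + (2 * a + 1) * E, by omega, fun i j hi hi' hj hj' hij => ?_⟩
  have hl := (hw a (by omega)).2.2 (i - (b + (2 * a + 1) * E)) (j - b) (by omega) (by
    push_cast [Nat.cast_sub hi, Nat.cast_sub (show b ≤ j by omega)]
    rw [hij]
    ring)
  have hr := (hw a' ha').2.1 (j - b) (by omega)
  rw [heq, hr] at hl
  rw [show b + (j - b) = j by omega,
    show b + (2 * a + 1) * E + (i - (b + (2 * a + 1) * E)) = i by omega] at hl
  exact hl.symm

/-- An isometry of finite order of a `k`-geodetic graph which moves the vertices of arbitrarily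
long geodesics by a bounded amount has a fixed vertex. -/
theorem IsKGeodetic.exists_fixed {V : Type*} {X : SimpleGraph V} {k : ℕ} (hX : IsKGeodetic X k)
    {φ : V → V} (hφ : ∀ x y, X.dist (φ x) (φ y) = X.dist x y) {r : ℕ} (hr : 0 < r)
    (hφr : φ^[r] = id) (R : ℕ)
    (hlong : ∀ L, ∃ γ : ℕ → V, (∀ i j, i ≤ j → j ≤ L → X.dist (γ i) (γ j) = j - i) ∧
      ∀ i ≤ L, X.dist (γ i) (φ (γ i)) ≤ R) :
    ∃ x, φ x = x := by
  obtain ⟨γ, hγ, hR⟩ := hlong (r * R * (2 * k + 2) ^ (2 * R + 1))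
  set L := r * R * (2 * k + 2) ^ (2 * R + 1) with hL
  have hup : ∀ p q, p ≤ q → q ≤ L → (X.dist (γ p) (φ (γ q)) : ℤ) - (q - p) ≤ R := by
    intro p q hpq hq
    have h1 := hX.1.dist_triangle (u := γ p) (v := γ q) (w := φ (γ q))
    have h2 := hR q hq
    rw [hγ p q hpq hq] at h1
    omega
  have hlow : ∀ p q, p ≤ q → q ≤ L → -(R : ℤ) ≤ (X.dist (γ p) (φ (γ q)) : ℤ) - (q - p) := by
    intro p q hpq hq
    have h1 := hX.1.dist_triangle (u := γ p) (v := φ (γ q)) (w := γ q)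
    have h2 := hR q hq
    rw [hγ p q hpq hq, X.dist_comm (u := φ (γ q))] at h1
    omega
  obtain ⟨b, E, hDE, hbE, hE⟩ := exists_const_on_subdivision
    (fun p q => (X.dist (γ p) (φ (γ q)) : ℤ) - (q - p)) R (r * R) (2 * k + 2) L
    (fun p p' q' q h1 h2 h3 h4 => by
      have t1 := hX.1.dist_triangle (u := γ p) (v := γ p') (w := φ (γ q))
      have t2 := hX.1.dist_triangle (u := γ p') (v := φ (γ q')) (w := φ (γ q))
      rw [hγ p p' h1 (by omega)] at t1
      rw [hφ, hγ q' q h3 h4] at t2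
      omega) hlow hup le_rfl (by omega)
  obtain ⟨e, he⟩ : ∃ e, e = (X.dist (γ b) (φ (γ (b + (2 * k + 2) * E))) : ℤ)
    - ((b + (2 * k + 2) * E : ℕ) - b) := ⟨_, rfl⟩
  have hup' := hup b _ (Nat.le_add_right _ _) hbE
  have hlow' := hlow b _ (Nat.le_add_right _ _) hbE
  rw [← he] at hup' hlow'
  obtain ⟨A, hAL, hA⟩ := exists_shift_of_const hX hφ (e := e) hγ hbE
    (by rw [he]; push_cast; ring) fun a ha => by
      have := hE a ha
      rw [← he] at this
      rw [← this]
      push_cast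
      ring
  have hdist : ∀ s : ℕ, s ≤ R → γ A = γ (A + r * s) → s = 0 := by
    intro s hs h
    have h1 : r * s ≤ r * R := Nat.mul_le_mul_left _ hs
    have h2 := hγ A (A + r * s) (by omega) (by omega)
    rw [← h, SimpleGraph.dist_self] at h2
    have h3 : r * s = 0 := by omega
    rcases Nat.mul_eq_zero.1 h3 with h4 | h4 <;> omega
  have hrs : ∀ s : ℕ, s ≤ R → A + r * s ≤ A + E := fun s hs => by
    have h1 : r * s ≤ r * R := Nat.mul_le_mul_left _ hs
    omega
  have he0 : e = 0 := by
    obtain ⟨s, rfl | rfl⟩ := e.eq_nat_or_neg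
    · have hs : s ≤ R := by omega
      have h := iterate_eq_of_shift (φ := φ) (γ := γ) (A := A) (B := A + E) (s := s)
        (fun i h1 h2 => hA i (i + s) h1 (by omega) (by omega) h2 (by push_cast; rfl)) r (hrs s hs)
      rw [hφr] at h
      exact_mod_cast hdist s hs h
    · have hs : s ≤ R := by omega
      have h := iterate_eq_of_shift_back (φ := φ) (γ := γ) (A := A) (B := A + E) (s := s)
        (fun i h1 h2 => hA (i + s) i (by omega) h2 h1 (by omega) (by push_cast; ring)) r (hrs s hs)
      rw [hφr] at h
      have := hdist s hs h.symm
      omega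
  exact ⟨γ A, hA A A le_rfl (by omega) le_rfl (by omega) (by omega)⟩

lemma cayleyGraph_adj_mul_left {G : Type*} [Group G] (S : Set G) (t x y : G) :
    (cayleyGraph G S).Adj (t * x) (t * y) ↔ (cayleyGraph G S).Adj x y := by
  simp [cayleyGraph, SimpleGraph.fromRel_adj, mul_assoc]

lemma cayleyGraph_dist_mul_left_s10 {G : Type*} [Group G] {S : Set G}
    (hc : (cayleyGraph G S).Connected) (t x y : G) :
    (cayleyGraph G S).dist (t * x) (t * y) = (cayleyGraph G S).dist x y := by
  have hle : ∀ t x y : G,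
      (cayleyGraph G S).dist (t * x) (t * y) ≤ (cayleyGraph G S).dist x y := by
    intro t x y
    obtain ⟨p, hp⟩ := hc.exists_walk_length_eq_dist x y
    let f : cayleyGraph G S →g cayleyGraph G S :=
      ⟨fun z => t * z, fun h => (cayleyGraph_adj_mul_left S t _ _).2 h⟩
    rw [← hp, ← SimpleGraph.Walk.length_map f p]
    exact SimpleGraph.dist_le _
  refine le_antisymm (hle t x y) ?_
  simpa using hle t⁻¹ (t * x) (t * y)

lemma finite_cayleyGraph_ball {G : Type*} [Group G] {S : Set G} (hfin : S.Finite)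
    (hinv : ∀ s ∈ S, s⁻¹ ∈ S) (hc : (cayleyGraph G S).Connected) (n : ℕ) :
    {x : G | (cayleyGraph G S).dist 1 x ≤ n}.Finite := by
  induction n with
  | zero =>
    refine (Set.finite_singleton (1 : G)).subset fun x hx => ?_
    have h0 : (cayleyGraph G S).dist 1 x = 0 := by simpa using hx
    exact ((hc.dist_eq_zero_iff).1 h0).symm
  | succ n ih =>
    refine (ih.union (Set.Finite.image2 (fun x s => x * s) ih hfin)).subset fun x hx => ?_
    by_cases hxn : (cayleyGraph G S).dist 1 x ≤ n
    · exact Or.inl hxn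
    right
    have hx' : (cayleyGraph G S).dist 1 x = n + 1 := by
      have : (cayleyGraph G S).dist 1 x ≤ n + 1 := hx
      omega
    obtain ⟨p, hp⟩ := hc.exists_walk_length_eq_dist 1 x
    have hadj := p.adj_getVert_succ (i := n) (by omega)
    rw [p.getVert_of_length_le (by omega : p.length ≤ n + 1)] at hadj
    have hy : (cayleyGraph G S).dist 1 (p.getVert n) ≤ n :=
      (SimpleGraph.dist_le (p.take n)).trans (by simp)
    refine ⟨p.getVert n, hy, (p.getVert n)⁻¹ * x, ?_, by simp⟩
    rcases (SimpleGraph.fromRel_adj _ _ _).1 hadj with ⟨-, h | h⟩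
    · exact h
    · simpa using hinv _ h

/-- In a hyperbolic group with a `k`-geodetic Cayley graph, an element of finite order which
commutes with an element of infinite order is trivial. -/
theorem eq_one_of_commute_of_isOfFinOrder {G : Type*} [Group G] {k : ℕ} {S : Set G}
    (hfin : S.Finite) (hinv : ∀ s ∈ S, s⁻¹ ∈ S) (hhyp : IsHyperbolic (cayleyGraph G S))
    (hgeo : IsKGeodetic (cayleyGraph G S) k) {g t : G} (hcomm : Commute g t)
    (hg : ¬ IsOfFinOrder g) (ht : IsOfFinOrder t) : t = 1 := by
  have hc := hgeo.1
  obtain ⟨δ, hδ, hyp⟩ := hhyp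
  obtain ⟨r, hr, htr⟩ := isOfFinOrder_iff_pow_eq_one.1 ht
  set X := cayleyGraph G S with hX
  have hdist : ∀ x y, X.dist (t * x) (t * y) = X.dist x y := cayleyGraph_dist_mul_left_s10 hc t
  obtain ⟨x, hx⟩ := hgeo.exists_fixed (φ := fun x => t * x) hdist hr
    (by rw [mul_left_iterate, htr]; ext; simp) ⌈(X.dist 1 t : ℝ) + 2 * δ⌉₊ (by
      intro L
      obtain ⟨n, hn⟩ : ∃ n : ℕ, L ≤ X.dist 1 (g ^ n) := by
        by_contra! hlt
        exact Set.infinite_range_of_injective (injective_pow_iff_not_isOfFinOrder.2 hg)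
          ((finite_cayleyGraph_ball hfin hinv hc L).subset
            (Set.range_subset_iff.2 fun n => (hlt n).le))
      obtain ⟨p, hp⟩ := hc.exists_walk_length_eq_dist 1 (g ^ n)
      have hub : ∀ i j, i ≤ j → X.dist (p.getVert i) (p.getVert j) ≤ j - i := by
        intro i j hij
        have h : X.dist (p.getVert i) ((p.drop i).getVert (j - i)) ≤ j - i :=
          (SimpleGraph.dist_le ((p.drop i).take (j - i))).trans (by simp)
        rwa [SimpleGraph.Walk.drop_getVert, Nat.add_sub_cancel' hij] at h
      have h0 : p.getVert 0 = 1 := p.getVert_zero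
      have h1 : p.getVert p.length = g ^ n := p.getVert_length
      have hgeod : ∀ i j, i ≤ j → j ≤ p.length →
          X.dist (p.getVert i) (p.getVert j) = j - i := by
        intro i j hij hj
        have u1 := hub 0 i (by omega)
        have u2 := hub i j hij
        have u3 := hub j p.length hj
        have t1 := hc.dist_triangle (u := p.getVert 0) (v := p.getVert i) (w := p.getVert j)
        have t2 := hc.dist_triangle (u := p.getVert 0) (v := p.getVert j)
          (w := p.getVert p.length)
        have : X.dist (p.getVert 0) (p.getVert p.length) = p.length := by rw [h0, h1, hp]
        omega
      refine ⟨p.getVert, fun i j hij hj => hgeod i j hij (by omega), fun i hi => ?_⟩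
      have hi' : i ≤ p.length := by omega
      have e1 := hgeod 0 i (by omega) hi'
      have e2 := hgeod i p.length hi' le_rfl
      rw [h0] at e1
      rw [h1] at e2
      set x := p.getVert i with hx
      have hfar : X.dist (t * x) (g ^ n) ≤ (p.length - i) + X.dist 1 t := by
        have h := hc.dist_triangle (u := t * x) (v := t * g ^ n) (w := g ^ n)
        rw [hdist, e2, ← (hcomm.pow_left n).eq, X.dist_comm (u := g ^ n * t)] at h
        have h' := cayleyGraph_dist_mul_left_s10 hc (g ^ n) 1 t
        rw [mul_one, ← hX] at h'
        omega
      have hnear : X.dist (t * x) 1 ≤ i + X.dist 1 t := by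
        have h := hc.dist_triangle (u := t * x) (v := t * 1) (w := 1)
        rw [hdist, mul_one, X.dist_comm (u := x), e1, X.dist_comm (u := t)] at h
        omega
      have h4 := hyp x (t * x) 1 (g ^ n)
      rw [← hp, X.dist_comm (u := x) (v := 1), e1, e2] at h4
      have hm : max (((i - 0 : ℕ) : ℝ) + X.dist (t * x) (g ^ n))
          (((p.length - i : ℕ) : ℝ) + X.dist (t * x) 1) ≤ p.length + X.dist 1 t := by
        refine max_le ?_ ?_ <;> norm_cast <;> omega
      have hfin : (X.dist x (t * x) : ℝ) ≤ X.dist 1 t + 2 * δ := by linarith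
      exact_mod_cast hfin.trans (Nat.le_ceil _))
  simpa using hx

/-- Let `G` be a hyperbolic group with a finite inverse-closed
generating set `S` such that `Cay(G, S)` is `k`-geodetic. If `g, h ∈ G` are commuting
non-trivial elements and `g` has infinite order, then `h` has infinite order, and either
`h = g⁻¹` or `g * h` has infinite order. -/
theorem infiniteOrder_of_commuting {G : Type*} [Group G]
    (k : ℕ) (hk : 0 < k) (S : Set G) (hfin : S.Finite) (hinv : ∀ s ∈ S, s⁻¹ ∈ S)
    (hone : (1 : G) ∉ S) (hgen : Subgroup.closure S = ⊤)
    (hhyp : IsHyperbolic (cayleyGraph G S))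
    (hgeo : IsKGeodetic (cayleyGraph G S) k)
    (g h : G) (hg1 : g ≠ 1) (hh1 : h ≠ 1) (hcomm : g * h = h * g)
    (hord : ¬ IsOfFinOrder g) :
    ¬ IsOfFinOrder h ∧ (h = g⁻¹ ∨ ¬ IsOfFinOrder (g * h)) := by
  refine ⟨fun hh => hh1 (eq_one_of_commute_of_isOfFinOrder hfin hinv hhyp hgeo hcomm hord hh),
    or_iff_not_imp_right.2 fun hgh => ?_⟩
  have hprod := eq_one_of_commute_of_isOfFinOrder hfin hinv hhyp hgeo
    ((Commute.refl g).mul_right hcomm) hord (not_not.1 hgh)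
  exact eq_inv_of_mul_eq_one_right hprod
end
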